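/- arXiv:1505.00666 — 3 statements merged into one kernel-verified Lean document; each statement's English description precedes it below -/
import Mathlib

section
/- Let C : f = 0 be a nearly free reduced plane curve of degree d. Then there exist homogeneous relations r1, r2, r3 ∈ AR(f), of degrees d1 ≤ d2 ≤ d3 respectively, which generate AR(f) as an S-module and such that none of them lies in the S-submodule generated by the other two; moreover, the syzygy module among r1, r2, r3, i.e. the kernel of the S-linear map S³ → S³, (u1,u2,u3) ↦ u1·r1 + u2·r2 + u3·r3, is a free S-module of rank one, generated by a single triple R = (v1,v2,v3) of homogeneous polynomials with deg v_i = b − d_i + d − 1 for some integer b. (Equivalently, the Milnor algebra M(f) has a minimal graded free resolution 0 → S(−b−2(d−1)) → ⊕_{i=1,2,3} S(−d_i−(d−1)) → S(−d+1)³ → S.) -/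
open MvPolynomial

noncomputable section

/-- The polynomial ring `S = ℂ[x,y,z]`. -/
abbrev S : Type := MvPolynomial (Fin 3) ℂ

/-- The Jacobian ideal of `f`, spanned by the three partial derivatives. -/
def Jf (f : S) : Ideal S := Ideal.span {pderiv 0 f, pderiv 1 f, pderiv 2 f}

/-- The irrelevant maximal ideal `m = (x,y,z)`. -/
def mId : Ideal S := Ideal.span {X 0, X 1, X 2}

/-- The saturation `I_f` of the Jacobian ideal with respect to `m`. -/
def Isat (f : S) : Ideal S := ⨆ n : ℕ, Submodule.colon (Jf f) ((mId ^ n : Ideal S) : Submodule S S)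

/-- The quotient map `S → M(f) = S/J_f`, as a `ℂ`-linear map. -/
def quotC (f : S) : S →ₗ[ℂ] (S ⧸ (Jf f : Submodule S S)) :=
  ((Jf f : Submodule S S).mkQ).restrictScalars ℂ

/-- Degree-`k` homogeneous component of `S`, as a `ℂ`-subspace. -/
def Sgr (k : ℕ) : Submodule ℂ S := homogeneousSubmodule (Fin 3) ℂ k

/-- The degree-`k` part of the Milnor algebra `M(f)`. -/
def Msub (f : S) (k : ℕ) : Submodule ℂ (S ⧸ (Jf f : Submodule S S)) := (Sgr k).map (quotC f)

/-- `m(f)_k`, the dimension of the degree-`k` part of the Milnor algebra. -/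
def mdim (f : S) (k : ℕ) : ℕ := Module.finrank ℂ (Msub f k)

/-- The degree-`k` part of the Jacobian module `N(f) = I_f/J_f`, realized inside `S/J_f`. -/
def Nsub (f : S) (k : ℕ) : Submodule ℂ (S ⧸ (Jf f : Submodule S S)) :=
  (((Isat f).restrictScalars ℂ) ⊓ Sgr k).map (quotC f)

/-- `dim_ℂ N(f)_k`. -/
def ndim (f : S) (k : ℕ) : ℕ := Module.finrank ℂ (Nsub f k)

/-- The Jacobian module `N(f) = I_f/J_f`, as an `S`-submodule of `S/J_f`. -/
def Nmod (f : S) : Submodule S (S ⧸ (Jf f : Submodule S S)) :=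
  Submodule.map ((Jf f : Submodule S S).mkQ) (Isat f : Submodule S S)

/-- The Jacobian module `N(f)` as a `ℂ`-subspace of `S/J_f`. -/
def NsubTot (f : S) : Submodule ℂ (S ⧸ (Jf f : Submodule S S)) :=
  ((Isat f).restrictScalars ℂ).map (quotC f)

/-- `dim_ℂ N(f)`. -/
def ndimTot (f : S) : ℕ := Module.finrank ℂ (NsubTot f)

/-- `C : f = 0` is nearly free: `N(f) ≠ 0` and `dim N(f)_k ≤ 1` for all `k`. -/
def NearlyFree (f : S) : Prop := Nmod f ≠ ⊥ ∧ ∀ k : ℕ, ndim f k ≤ 1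

/-- `f` defines a union of lines passing through one point. -/
def IsConeOfLines (f : S) : Prop :=
  ∃ q : Fin 3 → ℂ, q ≠ 0 ∧ ∃ (c : ℂ) (L : Multiset S),
    (∀ l ∈ L, l ∈ Sgr 1 ∧ eval q l = 0) ∧ f = C c * L.prod

/-- The defining equation map `(a,b,c) ↦ a f_x + b f_y + c f_z`. -/
def eqnMap (f : S) : (Fin 3 → S) →ₗ[S] S where
  toFun r := ∑ i, r i * pderiv i f
  map_add' a b := by simp [add_mul, Finset.sum_add_distrib]
  map_smul' c a := by simp [Finset.mul_sum, mul_assoc]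

/-- `AR(f)`, the module of all relations among the partial derivatives of `f`. -/
def ARmod (f : S) : Submodule S (Fin 3 → S) := LinearMap.ker (eqnMap f)

/-- A triple of polynomials is homogeneous of degree `m` (componentwise). -/
def IsHomRel (r : Fin 3 → S) (m : ℕ) : Prop := ∀ i, r i ∈ Sgr m

/-- The set of degrees of nonzero homogeneous relations in `AR(f)`;
its least element is `mdr(f)`. -/
def mdrSet (f : S) : Set ℕ := {m | ∃ r ∈ ARmod f, r ≠ 0 ∧ IsHomRel r m}

/-- The map `(u₁,u₂,u₃) ↦ u₁ r₁ + u₂ r₂ + u₃ r₃` whose kernel is the syzygy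
module among `r₁, r₂, r₃`. -/
def syzMap (r : Fin 3 → (Fin 3 → S)) : (Fin 3 → S) →ₗ[S] (Fin 3 → S) where
  toFun u := ∑ j, u j • r j
  map_add' a b := by simp [add_smul, Finset.sum_add_distrib]
  map_smul' c a := by simp [Finset.smul_sum, smul_smul]

/-- `M(f)` has a minimal graded free resolution
`0 → S(−b−2(d−1)) → ⊕ᵢ S(−dᵢ−(d−1)) → S(−d+1)³ → S`; equivalently, `AR(f)` is
generated by three homogeneous relations of degrees `d₁, d₂, d₃`, none lying in
the submodule spanned by the other two, whose syzygy module is free of rank one,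
generated by a homogeneous triple `(v₁,v₂,v₃)` with `deg vᵢ = b − dᵢ + d − 1`. -/
def HasResolution (f : S) (d : ℕ) (dd : Fin 3 → ℕ) (b : ℤ) : Prop :=
  ∃ r : Fin 3 → (Fin 3 → S),
    (∀ j, r j ∈ ARmod f) ∧
    (∀ j, IsHomRel (r j) (dd j)) ∧
    Submodule.span S (Set.range r) = ARmod f ∧
    (∀ j, r j ∉ Submodule.span S (r '' {k | k ≠ j})) ∧
    ∃ v : Fin 3 → S, v ≠ 0 ∧
      (∀ j, ∃ e : ℕ, (e : ℤ) = b - dd j + d - 1 ∧ v j ∈ Sgr e) ∧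
      LinearMap.ker (syzMap r) = Submodule.span S {v}

/-- The Hilbert function of the Milnor algebra of a smooth plane curve of
degree `d`: the coefficient of `t^k` in `((1 − t^{d−1})/(1 − t))³`. -/
def msHilb (d k : ℕ) : ℕ :=
  (((∑ i ∈ Finset.range (d - 1), (Polynomial.X : Polynomial ℕ) ^ i)) ^ 3).coeff k

/-- `τ` is the total Tjurina number of `C : f = 0`, i.e. the common value of
`m(f)_k` for all sufficiently large `k`. -/
def TjurinaIs (f : S) (τ : ℕ) : Prop := ∃ N : ℕ, ∀ k ≥ N, mdim f k = τ


theorem mem_mId_iff (p : S) : p ∈ mId ↔ constantCoeff p = 0 := by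
  have h : mId = Ideal.span ((X : Fin 3 → S) '' Set.univ) := by
    unfold mId
    congr 1
    ext q
    simp [Fin.exists_fin_succ, eq_comm]
  rw [h, mem_ideal_span_X_image]
  constructor
  · intro hm
    by_contra hne
    obtain ⟨i, _, hi⟩ := hm 0 (by simpa [mem_support_iff, constantCoeff_eq] using hne)
    exact hi rfl
  · intro h0 m hm
    by_contra! hcon
    have : m = 0 := by ext i; simpa using hcon i (Set.mem_univ _)
    subst this
    rw [mem_support_iff] at hm
    exact hm (by simpa [constantCoeff_eq] using h0)

theorem mem_mId_iff' (p : S) : p ∈ mId ↔ ∃ a b c : S, p = X 0 * a + X 1 * b + X 2 * c := by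
  unfold mId
  rw [Ideal.mem_span_insert']
  constructor
  · rintro ⟨a, ha⟩
    rw [Ideal.mem_span_pair] at ha
    obtain ⟨b, c, h⟩ := ha
    exact ⟨-a, b, c, by linear_combination -h⟩
  · rintro ⟨a, b, c, h⟩
    refine ⟨-a, ?_⟩
    rw [Ideal.mem_span_pair]
    exact ⟨b, c, by rw [h]; ring⟩

theorem X_mem_mId (i : Fin 3) : (X i : S) ∈ mId := by
  rw [mem_mId_iff]; simp

def Kos2 (x y : S) : Prop := ∀ p q : S, x * p = y * q → ∃ t, p = y * t ∧ q = x * t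

def Kos3 (x y z : S) : Prop := ∀ p q r : S, x * p + y * q + z * r = 0 →
  ∃ A B C : S, p = y * C - z * B ∧ q = z * A - x * C ∧ r = x * B - y * A

theorem kos2_X {a b : Fin 3} (hab : a ≠ b) : Kos2 (X a) (X b) := by
  intro p q h
  have hp : Prime (X b : S) := MvPolynomial.X_prime
  have h1 : (X b : S) ∣ X a * p := ⟨q, h⟩
  rcases hp.dvd_or_dvd h1 with h2 | ⟨t, ht⟩
  · rw [X_dvd_X] at h2
    exact absurd h2.symm hab
  · refine ⟨t, ht, ?_⟩
    have : (X b : S) * q = X b * (X a * t) := by rw [← h, ht]; ring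
    exact mul_left_cancel₀ (X_ne_zero b) this

theorem kos3_X {a b j : Fin 3} (hab : a ≠ b) (haj : a ≠ j) (hbj : b ≠ j) (n : ℕ) :
    Kos3 (X a) (X b) (X j ^ n) := by
  intro p q r h
  have hr : r ∈ Ideal.span ((X : Fin 3 → S) '' {a, b}) := by
    have h1 : X j ^ n * r ∈ Ideal.span ((X : Fin 3 → S) '' {a, b}) := by
      have : X j ^ n * r = (-p) * X a + (-q) * X b := by linear_combination h
      rw [this]
      exact Ideal.add_mem _ (Ideal.mul_mem_left _ _ (Ideal.subset_span ⟨a, by simp, rfl⟩))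
        (Ideal.mul_mem_left _ _ (Ideal.subset_span ⟨b, by simp, rfl⟩))
    rw [mem_ideal_span_X_image] at h1 ⊢
    intro m hm
    have h2 : Finsupp.single j n + m ∈ (X j ^ n * r).support := by
      rw [mem_support_iff] at hm ⊢
      rw [X_pow_eq_monomial, coeff_monomial_mul]
      simpa using hm
    obtain ⟨i, hi, hi2⟩ := h1 _ h2
    refine ⟨i, hi, ?_⟩
    have hij : j ≠ i := by
      rcases hi with rfl | rfl
      · exact haj.symm
      · exact hbj.symm
    simpa [Finsupp.single_apply, hij] using hi2
  rw [Set.image_pair, Ideal.mem_span_pair] at hr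
  obtain ⟨B, A, hBA⟩ := hr
  obtain ⟨t, ht1, ht2⟩ := kos2_X hab (p + X j ^ n * B) (-(q + X j ^ n * A))
    (by linear_combination h + X j ^ n * hBA)
  exact ⟨-A, B, t, by linear_combination ht1, by linear_combination -ht2, by linear_combination -hBA⟩

theorem Kos2.map (e : S ≃ₐ[ℂ] S) {x y : S} (h : Kos2 x y) : Kos2 (e x) (e y) := by
  intro p q hpq
  obtain ⟨t, h1, h2⟩ := h (e.symm p) (e.symm q) (by apply e.injective; simpa using hpq)
  refine ⟨e t, ?_, ?_⟩
  · rw [← map_mul, ← h1]; simp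
  · rw [← map_mul, ← h2]; simp

theorem Kos3.map (e : S ≃ₐ[ℂ] S) {x y z : S} (h : Kos3 x y z) : Kos3 (e x) (e y) (e z) := by
  intro p q r hpq
  obtain ⟨A, B, C, h1, h2, h3⟩ := h (e.symm p) (e.symm q) (e.symm r)
    (by apply e.injective; simpa using hpq)
  refine ⟨e A, e B, e C, ?_, ?_, ?_⟩
  · rw [← map_mul, ← map_mul, ← map_sub, ← h1]; simp
  · rw [← map_mul, ← map_mul, ← map_sub, ← h2]; simp
  · rw [← map_mul, ← map_mul, ← map_sub, ← h3]; simp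

/-- shear automorphism -/
def shearHom (j : Fin 3) (μ : Fin 3 → ℂ) : S →ₐ[ℂ] S :=
  aeval (fun i => if i = j then X j else X i - C (μ i) * X j)

theorem shear_comp (j : Fin 3) (μ : Fin 3 → ℂ) :
    (shearHom j μ).comp (shearHom j (-μ)) = AlgHom.id ℂ S := by
  apply MvPolynomial.algHom_ext
  intro i
  by_cases h : i = j
  · simp [shearHom, h]
  · simp [shearHom, h, MvPolynomial.algHom_C, MvPolynomial.algebraMap_eq]

def shear (j : Fin 3) (μ : Fin 3 → ℂ) : S ≃ₐ[ℂ] S :=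
  AlgEquiv.ofAlgHom (shearHom j μ) (shearHom j (-μ)) (shear_comp j μ)
    (by simpa using shear_comp j (-μ))

theorem shear_X_self (j : Fin 3) (μ : Fin 3 → ℂ) : shear j μ (X j) = X j := by
  change shearHom j μ (X j) = X j
  rw [shearHom, aeval_X, if_pos rfl]

theorem shear_X_ne {i j : Fin 3} (h : i ≠ j) (μ : Fin 3 → ℂ) :
    shear j μ (X i) = X i - C (μ i) * X j := by
  change shearHom j μ (X i) = _
  rw [shearHom, aeval_X, if_neg h]

theorem kos_lin2 {a b j : Fin 3} (hab : a ≠ b) (haj : a ≠ j) (hbj : b ≠ j) (μ : Fin 3 → ℂ) :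
    Kos2 (X a - C (μ a) * X j) (X b - C (μ b) * X j) := by
  have := (kos2_X hab).map (shear j μ)
  rwa [shear_X_ne haj, shear_X_ne hbj] at this

theorem kos_lin3 {a b j : Fin 3} (hab : a ≠ b) (haj : a ≠ j) (hbj : b ≠ j) (μ : Fin 3 → ℂ) (n : ℕ) :
    Kos3 (X a - C (μ a) * X j) (X b - C (μ b) * X j) (X j ^ n) := by
  have := (kos3_X hab haj hbj n).map (shear j μ)
  rwa [shear_X_ne haj, shear_X_ne hbj, map_pow, shear_X_self] at this

theorem kos012 : Kos3 (X 0) (X 1) (X 2) := by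
  simpa using kos3_X (a := 0) (b := 1) (j := 2) (by decide) (by decide) (by decide) 1

theorem kos012' (A B C : S) (h1 : X 1 * C = X 2 * B) (h2 : X 2 * A = X 0 * C)
    (h3 : X 0 * B = X 1 * A) : ∃ h : S, A = X 0 * h ∧ B = X 1 * h ∧ C = X 2 * h := by
  obtain ⟨t, ht1, ht2⟩ := kos2_X (a := 0) (b := 1) (by decide) B A h3
  refine ⟨t, ht2, ht1, ?_⟩
  apply mul_left_cancel₀ (X_ne_zero (R := ℂ) (1 : Fin 3))
  rw [h1, ht1]; ring


def psi {ι : Type} [Fintype ι] (p : ι → S) : (ι → S) →ₗ[S] S := Fintype.linearCombination S p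

abbrev KK {ι : Type} [Fintype ι] (p : ι → S) : Submodule S (ι → S) := LinearMap.ker (psi p)

abbrev mK {ι : Type} [Fintype ι] (p : ι → S) : Submodule S (KK p) := mId • ⊤

theorem sub_const_mem (r : S) : r - C (constantCoeff r) ∈ mId := by
  rw [mem_mId_iff]; simp

theorem mkQ_smul {ι : Type} [Fintype ι] (p : ι → S) (r : S) (x : KK p) :
    (mK p).mkQ (r • x) = constantCoeff r • (mK p).mkQ x := by
  have h1 : constantCoeff r • (mK p).mkQ x = (mK p).mkQ ((C (constantCoeff r) : S) • x) := by
    rw [LinearMap.map_smul, ← MvPolynomial.algebraMap_eq, algebraMap_smul]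
  have h2 : r • x - (C (constantCoeff r) : S) • x = (r - C (constantCoeff r)) • x :=
    (sub_smul _ _ _).symm
  rw [h1, ← sub_eq_zero, ← map_sub, h2, Submodule.mkQ_apply, Submodule.Quotient.mk_eq_zero]
  exact Submodule.smul_mem_smul (sub_const_mem r) trivial

theorem finV {ι : Type} [Fintype ι] (p : ι → S) : Module.Finite ℂ ((KK p) ⧸ mK p) := by
  obtain ⟨s, hs⟩ := (Module.Finite.fg_top : (⊤ : Submodule S (KK p)).FG)
  classical
  refine ⟨⟨s.image (mK p).mkQ, ?_⟩⟩
  rw [eq_top_iff]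
  rintro v -
  obtain ⟨k, rfl⟩ := (mK p).mkQ_surjective v
  have hk : k ∈ Submodule.span S (s : Set (KK p)) := by rw [hs]; trivial
  induction hk using Submodule.span_induction with
  | mem x hx => exact Submodule.subset_span (by
      rw [Finset.coe_image]; exact ⟨x, hx, rfl⟩)
  | zero => simp
  | add x y _ _ hx hy => rw [map_add]; exact Submodule.add_mem _ hx hy
  | smul a x _ hx => rw [mkQ_smul]; exact Submodule.smul_mem _ _ hx

theorem chase {ι σ : Type} [Fintype ι] [Fintype σ] (p : ι → S)
    (hsat : ∀ h : S, (∀ i, X i * h ∈ LinearMap.range (psi p)) → h ∈ LinearMap.range (psi p))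
    (κ : σ → KK p) (hind : LinearIndependent ℂ (fun j => (mK p).mkQ (κ j)))
    (u : S) (hu : u - 1 ∈ mId) (hspan : ∀ w : KK p, u • w ∈ Submodule.span S (Set.range κ)) :
    LinearIndependent S κ := by
  set φ : (σ → S) →ₗ[S] KK p := Fintype.linearCombination S κ with hφ
  have hker : LinearMap.ker φ ≤ mId • LinearMap.ker φ := by
    intro n hn
    rw [LinearMap.mem_ker] at hn
    have hc : ∀ j, n j ∈ mId := by
      have h1 : ∑ j, constantCoeff (n j) • (mK p).mkQ (κ j) = 0 := by
        simp_rw [← mkQ_smul]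
        rw [← map_sum]
        have : ∑ j, n j • κ j = 0 := hn
        rw [this, map_zero]
      intro j
      rw [mem_mId_iff]
      exact Fintype.linearIndependent_iff.1 hind _ h1 j
    simp_rw [mem_mId_iff'] at hc
    choose a b c habc using hc
    have hn' : n = (X 0 : S) • a + (X 1 : S) • b + (X 2 : S) • c := by
      ext1 j; simpa using habc j
    have hP : ∀ i, X 0 * (φ a).1 i + X 1 * (φ b).1 i + X 2 * (φ c).1 i = 0 := by
      intro i
      rw [hn', map_add, map_add, map_smul, map_smul, map_smul] at hn
      have := congrFun (congrArg Subtype.val hn) i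
      simpa using this
    choose A B D hA hB hD using fun i => kos012 _ _ _ (hP i)
    have hA' : (φ a).1 = (X 1 : S) • D - (X 2 : S) • B := by ext1 i; simpa using hA i
    have hB' : (φ b).1 = (X 2 : S) • A - (X 0 : S) • D := by ext1 i; simpa using hB i
    have hD' : (φ c).1 = (X 0 : S) • B - (X 1 : S) • A := by ext1 i; simpa using hD i
    have k1 : psi p (φ a).1 = 0 := (φ a).2
    have k2 : psi p (φ b).1 = 0 := (φ b).2
    have k3 : psi p (φ c).1 = 0 := (φ c).2
    rw [hA', map_sub, map_smul, map_smul, sub_eq_zero, smul_eq_mul, smul_eq_mul] at k1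
    rw [hB', map_sub, map_smul, map_smul, sub_eq_zero, smul_eq_mul, smul_eq_mul] at k2
    rw [hD', map_sub, map_smul, map_smul, sub_eq_zero, smul_eq_mul, smul_eq_mul] at k3
    obtain ⟨h, e0, e1, e2⟩ := kos012' _ _ _ k1 k2 k3
    obtain ⟨E, hE⟩ := hsat h (by
      intro i
      fin_cases i
      · exact ⟨A, e0⟩
      · exact ⟨B, e1⟩
      · exact ⟨D, e2⟩)
    have lift : ∀ w : ι → S, psi p w = 0 → ∃ α, (φ α).1 = u • w := by
      intro w hw
      have := hspan ⟨w, hw⟩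
      rw [← Fintype.range_linearCombination] at this
      obtain ⟨α, hα⟩ := this
      exact ⟨α, congrArg Subtype.val hα⟩
    obtain ⟨α, hα⟩ := lift (A - (X 0 : S) • E) (by rw [map_sub, map_smul, hE, e0]; simp)
    obtain ⟨β, hβ⟩ := lift (B - (X 1 : S) • E) (by rw [map_sub, map_smul, hE, e1]; simp)
    obtain ⟨γ, hγ⟩ := lift (D - (X 2 : S) • E) (by rw [map_sub, map_smul, hE, e2]; simp)
    have m1 : u • a - ((X 1 : S) • γ - (X 2 : S) • β) ∈ LinearMap.ker φ := by
      rw [LinearMap.mem_ker]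
      apply Subtype.ext
      simp only [map_sub, map_smul, Submodule.coe_sub, Submodule.coe_smul, hα, hβ, hγ, hA']
      ext1 i
      simp
      ring
    have m2 : u • b - ((X 2 : S) • α - (X 0 : S) • γ) ∈ LinearMap.ker φ := by
      rw [LinearMap.mem_ker]
      apply Subtype.ext
      simp only [map_sub, map_smul, Submodule.coe_sub, Submodule.coe_smul, hα, hβ, hγ, hB']
      ext1 i
      simp
      ring
    have m3 : u • c - ((X 0 : S) • β - (X 1 : S) • α) ∈ LinearMap.ker φ := by
      rw [LinearMap.mem_ker]
      apply Subtype.ext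
      simp only [map_sub, map_smul, Submodule.coe_sub, Submodule.coe_smul, hα, hβ, hγ, hD']
      ext1 i
      simp
      ring
    have : n = (X 0 : S) • (u • a - ((X 1 : S) • γ - (X 2 : S) • β))
        + (X 1 : S) • (u • b - ((X 2 : S) • α - (X 0 : S) • γ))
        + (X 2 : S) • (u • c - ((X 0 : S) • β - (X 1 : S) • α)) - (u - 1) • n := by
      nth_rewrite 2 [hn']
      rw [hn']
      ext1 i
      simp
      ring
    rw [this]
    refine Submodule.sub_mem _ (Submodule.add_mem _ (Submodule.add_mem _ ?_ ?_) ?_) ?_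
    · exact Submodule.smul_mem_smul (X_mem_mId 0) m1
    · exact Submodule.smul_mem_smul (X_mem_mId 1) m2
    · exact Submodule.smul_mem_smul (X_mem_mId 2) m3
    · exact Submodule.smul_mem_smul hu hn
  obtain ⟨r, hr, hr2⟩ := Submodule.exists_sub_one_mem_and_smul_eq_zero_of_fg_of_le_smul mId
    (LinearMap.ker φ) (IsNoetherian.noetherian _) hker
  have hr0 : r ≠ 0 := by
    rintro rfl
    rw [mem_mId_iff] at hr
    simp at hr
  rw [Fintype.linearIndependent_iff]
  intro g hg j
  have := congrFun (hr2 g hg) j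
  simpa [hr0] using this

theorem card_bound {ι σ : Type} [Fintype ι] [Fintype σ] (p : ι → S) (hp : p ≠ 0)
    (κ : σ → KK p) (hind : LinearIndependent S κ) : Fintype.card σ + 1 ≤ Fintype.card ι := by
  classical
  obtain ⟨i, hi⟩ := Function.ne_iff.1 hp
  have : LinearIndependent S (fun o : Option σ => (Option.elim o (Pi.single i 1) (fun j => (κ j).1) : ι → S)) := by
    rw [Fintype.linearIndependent_iff]
    intro g hg
    rw [Fintype.sum_option] at hg
    simp only [Option.elim_none, Option.elim_some] at hg
    have h1 := congrArg (psi p) hg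
    have h2 : ∀ j, psi p (κ j).1 = 0 := fun j => (κ j).2
    simp only [map_add, map_smul, map_sum, h2, smul_zero, Finset.sum_const_zero, add_zero, map_zero] at h1
    rw [psi, Fintype.linearCombination_apply_single] at h1
    have h0 : g none = 0 := by
      have hi' : p i ≠ 0 := hi
      simpa [hi'] using h1
    rw [h0, zero_smul, zero_add] at hg
    have h3 := Fintype.linearIndependent_iff.1 hind (fun j => g (some j)) (by
      apply Subtype.ext
      simpa using hg)
    rintro (_ | j)
    · exact h0
    · exact h3 j
  have h := this.fintype_card_le_finrank
  simpa using h

theorem span_of_basis {ι σ : Type} [Fintype ι] [Fintype σ] (p : ι → S)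
    (κ : σ → KK p) (hsp : ⊤ ≤ Submodule.span ℂ (Set.range (fun j => (mK p).mkQ (κ j)))) :
    ∃ u : S, u - 1 ∈ mId ∧ ∀ w : KK p, u • w ∈ Submodule.span S (Set.range κ) := by
  obtain ⟨u, hu, hu2⟩ := Submodule.exists_sub_one_mem_and_smul_le_of_fg_of_le_sup (I := mId)
    (N := Submodule.span S (Set.range κ)) (N' := (⊤ : Submodule S (KK p))) (P := ⊤)
    (IsNoetherian.noetherian _) le_rfl (by
      rintro w -
      have := hsp (x := (mK p).mkQ w) trivial
      rw [Submodule.mem_span_range_iff_exists_fun] at this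
      obtain ⟨c, hc⟩ := this
      have h2 : (mK p).mkQ (∑ j, (C (c j) : S) • κ j) = (mK p).mkQ w := by
        rw [map_sum, ← hc]
        refine Finset.sum_congr rfl fun j _ => ?_
        rw [mkQ_smul]; simp
      rw [← sub_eq_zero, ← map_sub, Submodule.mkQ_apply, Submodule.Quotient.mk_eq_zero] at h2
      have h3 : w = (∑ j, (C (c j) : S) • κ j) - (∑ j, (C (c j) : S) • κ j - w) := by abel
      rw [h3]
      refine Submodule.sub_mem _ (Submodule.mem_sup_left ?_) (Submodule.mem_sup_right h2)
      exact Submodule.sum_mem _ fun j _ => Submodule.smul_mem _ _ (Submodule.subset_span ⟨j, rfl⟩))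
  exact ⟨u, hu, fun w => hu2 (Submodule.smul_mem_pointwise_smul w u ⊤ trivial)⟩

theorem keyA {ι σ : Type} [Fintype ι] [Fintype σ] (p : ι → S) (hp : p ≠ 0)
    (hsat : ∀ h : S, (∀ i, X i * h ∈ LinearMap.range (psi p)) → h ∈ LinearMap.range (psi p))
    (κ : σ → KK p) (hind : LinearIndependent ℂ (fun j => (mK p).mkQ (κ j))) :
    Fintype.card σ + 1 ≤ Fintype.card ι ∧ (Fintype.card σ + 1 = Fintype.card ι →
      LinearIndependent S κ ∧
      ∃ u : S, u - 1 ∈ mId ∧ ∀ w : KK p, u • w ∈ Submodule.span S (Set.range κ)) := by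
  have := finV p
  set b := Module.finBasis ℂ ((KK p) ⧸ mK p) with hb
  choose κ0 hκ0 using fun j => (mK p).mkQ_surjective (b j)
  have hbe : (fun j => (mK p).mkQ (κ0 j)) = b := funext hκ0
  obtain ⟨u, hu, hu2⟩ := span_of_basis p κ0 (by rw [hbe, b.span_eq])
  have h1 := card_bound p hp κ0 (chase p hsat κ0 (by rw [hbe]; exact b.linearIndependent) u hu hu2)
  rw [Fintype.card_fin] at h1
  have h2 := hind.fintype_card_le_finrank
  refine ⟨by omega, fun h3 => ?_⟩
  have h4 := hind.span_eq_top_of_card_eq_finrank' (by omega)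
  obtain ⟨u, hu, hu2⟩ := span_of_basis p κ (by rw [h4])
  exact ⟨chase p hsat κ hind u hu hu2, u, hu, hu2⟩


abbrev hc (k : ℕ) : S →ₗ[ℂ] S := homogeneousComponent k

theorem mem_Sgr {k : ℕ} {p : S} : p ∈ Sgr k ↔ p.IsHomogeneous k := Iff.rfl

theorem hc_of {m k : ℕ} {p : S} (h : p.IsHomogeneous m) : hc k p = if m = k then p else 0 := by
  have := homogeneousComponent_of_mem (n := m) (m := k) (p := p) h
  rw [hc, this]
  simp only [eq_comm]

theorem hc_mul (p : S) {q : S} {e : ℕ} (hq : q.IsHomogeneous e) (k : ℕ) :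
    hc k (p * q) = if e ≤ k then hc (k - e) p * q else 0 := by
  induction p using MvPolynomial.monomial_add_induction_on with
  | C a =>
    rw [hc_of ((isHomogeneous_C (Fin 3) a).mul hq), hc_of (isHomogeneous_C (Fin 3) a)]
    split_ifs <;> first | rfl | omega | simp
  | monomial_add m b g _ _ hg =>
    have hm : (monomial m b : S).IsHomogeneous m.degree := isHomogeneous_monomial b rfl
    rw [add_mul, map_add, hg, hc_of (hm.mul hq), map_add, hc_of hm]
    split_ifs <;> first | omega | simp [add_mul]

theorem sum_hc (p : S) : ∃ N : ℕ, p = ∑ k ∈ Finset.range N, hc k p :=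
  ⟨p.totalDegree + 1, (sum_homogeneousComponent p).symm⟩

theorem pd_hom {f : S} {d : ℕ} (hf : f.IsHomogeneous d) (i : Fin 3) :
    (pderiv i f).IsHomogeneous (d - 1) := hf.pderiv

theorem mem_Jf (f h : S) : h ∈ Jf f ↔ ∃ a : Fin 3 → S, h = ∑ i, a i * pderiv i f := by
  unfold Jf
  rw [Ideal.mem_span_insert']
  constructor
  · rintro ⟨a, ha⟩
    rw [Ideal.mem_span_pair] at ha
    obtain ⟨b, c, h⟩ := ha
    exact ⟨![-a, b, c], by simp [Fin.sum_univ_three]; linear_combination -h⟩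
  · rintro ⟨a, h⟩
    refine ⟨-a 0, ?_⟩
    rw [Ideal.mem_span_pair]
    exact ⟨a 1, a 2, by rw [h, Fin.sum_univ_three]; ring⟩

theorem hc_sum {f : S} {d : ℕ} (hf : f.IsHomogeneous d) (a : Fin 3 → S) (k : ℕ) :
    hc k (∑ i, a i * pderiv i f) =
      if d - 1 ≤ k then ∑ i, hc (k - (d - 1)) (a i) * pderiv i f else 0 := by
  rw [map_sum]
  simp_rw [hc_mul _ (pd_hom hf _)]
  split_ifs <;> simp

theorem hc_mem_Jf {f : S} {d : ℕ} (hf : f.IsHomogeneous d) {h : S} (hh : h ∈ Jf f) (k : ℕ) :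
    hc k h ∈ Jf f := by
  rw [mem_Jf] at hh
  obtain ⟨a, rfl⟩ := hh
  rw [hc_sum hf]
  split_ifs
  · rw [mem_Jf]; exact ⟨_, rfl⟩
  · simp

/-- homogeneous lift -/
theorem Jf_lift {f : S} {d : ℕ} (hf : f.IsHomogeneous d) {h : S} {k : ℕ} (hk : h.IsHomogeneous k)
    (h0 : h ≠ 0) (hh : h ∈ Jf f) : d - 1 ≤ k ∧ ∃ a : Fin 3 → S, (∀ i, (a i).IsHomogeneous (k - (d - 1))) ∧
      h = ∑ i, a i * pderiv i f := by
  rw [mem_Jf] at hh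
  obtain ⟨a, ha⟩ := hh
  have h1 := hc_sum hf a k
  rw [← ha, hc_of hk, if_pos rfl] at h1
  split_ifs at h1 with h2
  · exact ⟨h2, _, fun i => homogeneousComponent_isHomogeneous _ _, h1⟩
  · exact absurd h1 h0

def colN (f : S) (n : ℕ) : Ideal S := Submodule.colon (Jf f) ((mId ^ n : Ideal S) : Submodule S S)

theorem mem_colN {f : S} {n : ℕ} {h : S} : h ∈ colN f n ↔ ∀ q ∈ mId ^ n, h * q ∈ Jf f := by
  unfold colN
  rw [Submodule.mem_colon]
  rfl

theorem colN_zero {f : S} {h : S} : h ∈ colN f 0 ↔ h ∈ Jf f := by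
  rw [mem_colN, pow_zero]
  constructor
  · intro H; simpa using H 1 (by simp)
  · intro H q _; exact Ideal.mul_mem_right _ _ H

theorem colN_succ {f : S} {n : ℕ} {h : S} : h ∈ colN f (n + 1) ↔ ∀ i, X i * h ∈ colN f n := by
  constructor
  · intro H i
    rw [mem_colN] at H ⊢
    intro q hq
    have := H (q * X i) (by rw [pow_succ]; exact Ideal.mul_mem_mul hq (X_mem_mId i))
    convert this using 1; ring
  · intro H
    rw [mem_colN]
    intro q hq
    rw [pow_succ] at hq
    induction hq using Submodule.mul_induction_on' with
    | mem_mul_mem a ha b hb =>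
      rw [mem_mId_iff'] at hb
      obtain ⟨u, v, w, rfl⟩ := hb
      have h0 := mem_colN.1 (H 0) a ha
      have h1 := mem_colN.1 (H 1) a ha
      have h2 := mem_colN.1 (H 2) a ha
      have : h * (a * (X 0 * u + X 1 * v + X 2 * w)) =
        (X 0 * h * a) * u + (X 1 * h * a) * v + (X 2 * h * a) * w := by ring
      rw [this]
      exact Ideal.add_mem _ (Ideal.add_mem _ (Ideal.mul_mem_right _ _ h0)
        (Ideal.mul_mem_right _ _ h1)) (Ideal.mul_mem_right _ _ h2)
    | add a _ b _ ha hb => rw [mul_add]; exact Ideal.add_mem _ ha hb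

theorem colN_mono (f : S) : Monotone (colN f) := by
  intro m n hmn h hh
  rw [mem_colN] at hh ⊢
  exact fun q hq => hh q (Ideal.pow_le_pow_right hmn hq)

theorem mem_Isat {f h : S} : h ∈ Isat f ↔ ∃ n, h ∈ colN f n := by
  change h ∈ (⨆ n, colN f n) ↔ _
  exact Submodule.mem_iSup_of_directed _ (colN_mono f).directed_le

theorem Jf_le_Isat (f : S) : Jf f ≤ Isat f := fun _ hh => mem_Isat.2 ⟨0, colN_zero.2 hh⟩

theorem Isat_sat {f h : S} (H : ∀ i, X i * h ∈ Isat f) : h ∈ Isat f := by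
  simp_rw [mem_Isat] at H ⊢
  choose n hn using H
  refine ⟨Finset.univ.sup n + 1, colN_succ.2 fun i => ?_⟩
  exact colN_mono f (Finset.le_sup (Finset.mem_univ i)) (hn i)

theorem hc_mem_Isat {f : S} {d : ℕ} (hf : f.IsHomogeneous d) {h : S} (hh : h ∈ Isat f) (k : ℕ) :
    hc k h ∈ Isat f := by
  rw [mem_Isat] at hh ⊢
  obtain ⟨n, hn⟩ := hh
  refine ⟨n, ?_⟩
  induction n generalizing h k with
  | zero => rw [colN_zero] at hn ⊢; exact hc_mem_Jf hf hn k
  | succ n ih =>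
    rw [colN_succ] at hn ⊢
    intro i
    have := ih (k + 1) (hn i)
    rw [mul_comm, hc_mul _ (isHomogeneous_X ℂ i), if_pos (by omega)] at this
    simpa [mul_comm] using this

theorem pow_kills {f h : S} (hh : h ∈ Isat f) (j : Fin 3) : ∃ n, X j ^ n * h ∈ Jf f := by
  rw [mem_Isat] at hh
  obtain ⟨n, hn⟩ := hh
  refine ⟨n, ?_⟩
  rw [mul_comm]
  exact mem_colN.1 hn _ (Ideal.pow_mem_pow (X_mem_mId j) n)

theorem dep {f : S} (hnf : NearlyFree f) {e : ℕ} {g h : S} (hg : g ∈ Isat f) (hge : g.IsHomogeneous e)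
    (hgJ : g ∉ Jf f) (hh : h ∈ Isat f) (hhe : h.IsHomogeneous e) : ∃ c : ℂ, h - C c * g ∈ Jf f := by
  have hfin : Module.Finite ℂ (Nsub f e) := by
    have h1 : (Sgr e).FG := homogeneousSubmodule_fg _ _ e
    have : Module.Finite ℂ (Sgr e) := Module.Finite.iff_fg.2 h1
    have h2 : Module.Finite ℂ (((Isat f).restrictScalars ℂ ⊓ Sgr e : Submodule ℂ S)) :=
      Submodule.finiteDimensional_inf_right _ _
    exact Module.Finite.map _ _
  have hr := hnf.2 e
  rw [ndim, finrank_le_one_iff] at hr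
  obtain ⟨v, hv⟩ := hr
  obtain ⟨c1, h1⟩ := hv ⟨quotC f g, ⟨g, ⟨hg, hge⟩, rfl⟩⟩
  obtain ⟨c2, h2⟩ := hv ⟨quotC f h, ⟨h, ⟨hh, hhe⟩, rfl⟩⟩
  have h1' := congrArg Subtype.val h1
  have h2' := congrArg Subtype.val h2
  simp only [Submodule.coe_smul] at h1' h2'
  have hc1 : c1 ≠ 0 := by
    rintro rfl
    rw [zero_smul] at h1'
    exact hgJ ((Submodule.Quotient.mk_eq_zero _).1 h1'.symm)
  refine ⟨c2 / c1, ?_⟩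
  have h3 : quotC f (h - C (c2 / c1) * g) = 0 := by
    rw [← smul_eq_C_mul, map_sub, map_smul, ← h1', ← h2', smul_smul, div_mul_cancel₀ _ hc1, sub_self]
  exact (Submodule.Quotient.mk_eq_zero _).1 h3


structure Start (f : S) (e : ℕ) (g : S) : Prop where
  mem : g ∈ Isat f
  hom : g.IsHomogeneous e
  nmem : g ∉ Jf f
  low : ∀ e', e' + 1 = e → ∀ h ∈ Isat f, h.IsHomogeneous e' → ∀ i, X i * h ∈ Jf f

theorem gen_le {f : S} {d : ℕ} (hf : f.IsHomogeneous d) (hnf : NearlyFree f) (nn : ℕ → S)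
    (hnn : ∀ e, (∃ g, Start f e g) → Start f e (nn e)) :
    Isat f ≤ Jf f ⊔ Ideal.span (nn '' {e | ∃ g, Start f e g}) := by
  have key : ∀ e, ∀ h ∈ Isat f, h.IsHomogeneous e →
      h ∈ Jf f ⊔ Ideal.span (nn '' {e | ∃ g, Start f e g}) := by
    intro e
    induction e with
    | zero =>
      intro h hh he
      by_cases hJ : h ∈ Jf f
      · exact Submodule.mem_sup_left hJ
      have hs : Start f 0 h := ⟨hh, he, hJ, fun e' h => by omega⟩
      have hs' := hnn 0 ⟨h, hs⟩
      obtain ⟨c, hc⟩ := dep hnf hs'.mem hs'.hom hs'.nmem hh he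
      have : h = (h - C c * nn 0) + C c * nn 0 := by ring
      rw [this]
      exact Ideal.add_mem _ (Submodule.mem_sup_left hc) (Submodule.mem_sup_right
        (Ideal.mul_mem_left _ _ (Ideal.subset_span ⟨0, ⟨h, hs⟩, rfl⟩)))
    | succ e ih =>
      intro h hh he
      by_cases hJ : h ∈ Jf f
      · exact Submodule.mem_sup_left hJ
      by_cases hs : Start f (e + 1) h
      · have hs' := hnn (e + 1) ⟨h, hs⟩
        obtain ⟨c, hc⟩ := dep hnf hs'.mem hs'.hom hs'.nmem hh he
        have : h = (h - C c * nn (e + 1)) + C c * nn (e + 1) := by ring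
        rw [this]
        exact Ideal.add_mem _ (Submodule.mem_sup_left hc) (Submodule.mem_sup_right
          (Ideal.mul_mem_left _ _ (Ideal.subset_span ⟨e + 1, ⟨h, hs⟩, rfl⟩)))
      · have : ∃ h' ∈ Isat f, h'.IsHomogeneous e ∧ ∃ i, X i * h' ∉ Jf f := by
          by_contra! hcon
          refine hs ⟨hh, he, hJ, fun e' he' h' h1 h2 i => ?_⟩
          obtain rfl : e' = e := by omega
          exact hcon h' h1 h2 i
        obtain ⟨h', h1, h2, i, h3⟩ := this
        obtain ⟨c, hc⟩ := dep hnf (Ideal.mul_mem_left _ (X i) h1)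
          (by rw [add_comm]; exact (isHomogeneous_X ℂ i).mul h2) h3 hh he
        have : h = (h - C c * (X i * h')) + (C c * X i) * h' := by ring
        rw [this]
        exact Ideal.add_mem _ (Submodule.mem_sup_left hc) (Ideal.mul_mem_left _ _ (ih h' h1 h2))
  intro h hh
  obtain ⟨N, hN⟩ := sum_hc h
  rw [hN]
  exact Ideal.sum_mem _ fun k _ => key k _ (hc_mem_Isat hf hh k) (homogeneousComponent_isHomogeneous _ _)

abbrev pp (f : S) (T : Finset ℕ) (nn : ℕ → S) : Fin 3 ⊕ T → S :=
  Sum.elim (fun i => pderiv i f) (fun e => nn e)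

theorem exists_T {f : S} {d : ℕ} (hf : f.IsHomogeneous d) (hnf : NearlyFree f) :
    ∃ (T : Finset ℕ) (nn : ℕ → S), T.Nonempty ∧ (∀ e ∈ T, Start f e (nn e)) ∧
      ∀ h, h ∈ LinearMap.range (psi (pp f T nn)) ↔ h ∈ Isat f := by
  classical
  have : ∀ e, ∃ g, (∃ g, Start f e g) → Start f e g := by
    intro e
    by_cases h : ∃ g, Start f e g
    · exact ⟨h.choose, fun _ => h.choose_spec⟩
    · exact ⟨0, fun h' => absurd h' h⟩
  choose nn hnn using this
  have hle := gen_le hf hnf nn hnn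
  obtain ⟨s, hs1, hs2⟩ := (Submodule.fg_span_iff_fg_span_finset_subset
    (R := S) (nn '' {e | ∃ g, Start f e g})).1 (IsNoetherian.noetherian _)
  rw [Finset.subset_set_image_iff] at hs1
  obtain ⟨T, hT, rfl⟩ := hs1
  have hst : ∀ e ∈ T, Start f e (nn e) := fun e he => hnn e (hT he)
  have hle2 : Isat f ≤ Jf f ⊔ Ideal.span (nn '' T) := by
    rw [← Finset.coe_image, Ideal.span, ← hs2]; exact hle
  refine ⟨T, nn, ?_, hst, ?_⟩
  · by_contra hne
    rw [Finset.not_nonempty_iff_eq_empty] at hne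
    subst hne
    apply hnf.1
    rw [Nmod, eq_bot_iff, Submodule.map_le_iff_le_comap, Submodule.comap_bot, Submodule.ker_mkQ]
    simpa using hle2
  · intro h
    rw [psi, Fintype.range_linearCombination]
    constructor
    · intro hh
      refine (Submodule.span_le.2 ?_ : _ ≤ Isat f) hh
      rintro _ ⟨i | e, rfl⟩
      · apply Jf_le_Isat
        rw [mem_Jf]
        exact ⟨Pi.single i 1, by simp [Pi.single_apply]⟩
      · exact (hst e e.2).mem
    · intro hh
      refine (sup_le ?_ ?_ : Jf f ⊔ Ideal.span (nn '' T) ≤ _) (hle2 hh)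
      · intro q hq
        rw [mem_Jf] at hq
        obtain ⟨a, rfl⟩ := hq
        exact Ideal.sum_mem _ fun i _ => Ideal.mul_mem_left _ _
          (Submodule.subset_span ⟨Sum.inl i, rfl⟩)
      · refine Submodule.span_le.2 ?_
        rintro _ ⟨e, he, rfl⟩
        exact Submodule.subset_span ⟨Sum.inr ⟨e, he⟩, rfl⟩

theorem hom_split {q : S} {t : ℕ} (hq : q.IsHomogeneous (t + 1)) :
    ∃ a b c : S, a.IsHomogeneous t ∧ b.IsHomogeneous t ∧ c.IsHomogeneous t ∧
      q = X 0 * a + X 1 * b + X 2 * c := by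
  have h0 : q ∈ mId := by
    rw [mem_mId_iff, constantCoeff_eq]
    exact hq.coeff_eq_zero (by simp)
  rw [mem_mId_iff'] at h0
  obtain ⟨a, b, c, h⟩ := h0
  have h1 := congrArg (hc (t + 1)) h
  rw [hc_of hq, if_pos rfl] at h1
  rw [map_add, map_add, mul_comm, hc_mul _ (isHomogeneous_X ℂ 0), mul_comm (X 1),
    hc_mul _ (isHomogeneous_X ℂ 1), mul_comm (X 2), hc_mul _ (isHomogeneous_X ℂ 2)] at h1
  simp only [le_add_iff_nonneg_left, zero_le, if_true, Nat.add_sub_cancel] at h1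
  refine ⟨hc t a, hc t b, hc t c, homogeneousComponent_isHomogeneous _ _,
    homogeneousComponent_isHomogeneous _ _, homogeneousComponent_isHomogeneous _ _, ?_⟩
  rw [h1]; ring

theorem hom_mul_colN {f : S} (s : ℕ) : ∀ {t : ℕ} {q g : S}, q.IsHomogeneous t → s ≤ t → g ∈ colN f s →
    q * g ∈ Jf f := by
  induction s with
  | zero => intro t q g _ _ hg; exact Ideal.mul_mem_left _ _ (colN_zero.1 hg)
  | succ s ih =>
    intro t q g hq hst hg
    obtain ⟨t, rfl⟩ : ∃ t', t = t' + 1 := ⟨t - 1, by omega⟩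
    obtain ⟨a, b, c, ha, hb, hc, rfl⟩ := hom_split hq
    rw [colN_succ] at hg
    have : (X 0 * a + X 1 * b + X 2 * c) * g = a * (X 0 * g) + b * (X 1 * g) + c * (X 2 * g) := by ring
    rw [this]
    exact Ideal.add_mem _ (Ideal.add_mem _ (ih ha (by omega) (hg 0)) (ih hb (by omega) (hg 1)))
      (ih hc (by omega) (hg 2))

theorem Start.colN {f : S} {a : ℕ} {g : S} (hs : Start f a g) (s : ℕ) :
    ∀ (e : ℕ) (h : S), e + (s + 1) = a → h ∈ Isat f → h.IsHomogeneous e → h ∈ colN f (s + 1) := by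
  induction s with
  | zero =>
    intro e h he hh hhe
    rw [colN_succ]
    intro i
    rw [colN_zero]
    exact hs.low e (by omega) h hh hhe i
  | succ s ih =>
    intro e h he hh hhe
    rw [colN_succ]
    intro i
    exact ih (e + 1) _ (by omega) (Ideal.mul_mem_left _ _ hh)
      (by rw [add_comm]; exact (isHomogeneous_X ℂ i).mul hhe)

theorem comp_J {f : S} {d : ℕ} (hf : f.IsHomogeneous d) {T : Finset ℕ} {nn : ℕ → S}
    (hst : ∀ e ∈ T, Start f e (nn e)) (w : T → S) (hw : ∑ e, w e * nn e ∈ Jf f) (a : T) (k : ℕ)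
    (hak : a.1 ≤ k) (hT : ∀ e ∈ T, a.1 < e → k < e) : hc k (w a * nn a) ∈ Jf f := by
  classical
  have h1 := hc_mem_Jf hf hw k
  rw [map_sum, ← Finset.add_sum_erase _ _ (Finset.mem_univ a)] at h1
  refine (Ideal.add_mem_iff_left _ ?_).1 h1
  refine Ideal.sum_mem _ fun e he => ?_
  have hne : e ≠ a := (Finset.mem_erase.1 he).1
  have hne' : e.1 ≠ a.1 := fun h => hne (Subtype.ext h)
  have hse := hst e e.2
  rw [hc_mul _ hse.hom]
  split_ifs with hek
  · have hlt : e.1 < a.1 := by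
      by_contra hcon
      have := hT e e.2 (by omega)
      omega
    obtain ⟨s, hs⟩ : ∃ s, e.1 + (s + 1) = a.1 := ⟨a.1 - e.1 - 1, by omega⟩
    exact hom_mul_colN (s + 1) (homogeneousComponent_isHomogeneous _ _) (by omega)
      ((hst a a.2).colN s e.1 _ hs hse.mem hse.hom)
  · simp

theorem C_mul_mem {f g : S} (hg : g ∉ Jf f) {c : ℂ} (h : C c * g ∈ Jf f) : c = 0 := by
  by_contra hc
  apply hg
  have := Ideal.mul_mem_left (Jf f) (C c⁻¹) h
  rwa [← mul_assoc, ← C_mul, inv_mul_cancel₀ hc, C_1, one_mul] at this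

theorem const_zero {f : S} {d : ℕ} (hf : f.IsHomogeneous d) {T : Finset ℕ} {nn : ℕ → S}
    (hst : ∀ e ∈ T, Start f e (nn e)) (w : T → S) (hw : ∑ e, w e * nn e ∈ Jf f) (a : T) :
    constantCoeff (w a) = 0 := by
  have h := comp_J hf hst w hw a a.1 le_rfl (fun _ _ h => h)
  have hs := hst a a.2
  rw [hc_mul _ hs.hom, if_pos le_rfl, Nat.sub_self, hc, homogeneousComponent_zero] at h
  exact C_mul_mem hs.nmem h

theorem max_mem {f : S} {d : ℕ} (hf : f.IsHomogeneous d) {T : Finset ℕ} {nn : ℕ → S}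
    (hst : ∀ e ∈ T, Start f e (nn e)) (w : T → S) (hw : ∑ e, w e * nn e ∈ Jf f) (a : T)
    (ha : ∀ e ∈ T, e ≤ a.1) : w a * nn a ∈ Jf f := by
  obtain ⟨N, hN⟩ := sum_hc (w a * nn a)
  rw [hN]
  refine Ideal.sum_mem _ fun k _ => ?_
  by_cases hk : a.1 ≤ k
  · exact comp_J hf hst w hw a k hk (fun e he h => by have := ha e he; omega)
  · rw [hc_mul _ (hst a a.2).hom, if_neg hk]; simp

theorem lin_rel {f : S} (hnf : NearlyFree f) {e : ℕ} {g : S} (hg : g ∈ Isat f) (hge : g.IsHomogeneous e) :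
    ∃ (j : Fin 3) (μ : Fin 3 → ℂ), μ j = 1 ∧ ∀ i, (X i - C (μ i) * X j) * g ∈ Jf f := by
  classical
  by_cases h : ∃ j, X j * g ∉ Jf f
  · obtain ⟨j, hj⟩ := h
    have hh : ∀ i, (X i * g).IsHomogeneous (1 + e) := fun i => (isHomogeneous_X ℂ i).mul hge
    choose c hc using fun i => dep hnf (Ideal.mul_mem_left _ _ hg) (hh j) hj
      (Ideal.mul_mem_left _ (X i) hg) (hh i)
    refine ⟨j, Function.update c j 1, by simp, fun i => ?_⟩
    by_cases hij : i = j
    · subst hij; simp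
    · rw [Function.update_of_ne hij]
      have := hc i
      convert this using 1; ring
  · push Not at h
    refine ⟨0, Function.update 0 0 1, by simp, fun i => ?_⟩
    rw [sub_mul, mul_assoc]
    exact Ideal.sub_mem _ (h i) (Ideal.mul_mem_left _ _ (h 0))

def ev (μ : Fin 3 → ℂ) : S →ₐ[ℂ] Polynomial ℂ := aeval (fun i => Polynomial.C (μ i) * Polynomial.X)

theorem ev_sub {f g : S} {j : Fin 3} {μ : Fin 3 → ℂ} (h : ∀ i, (X i - C (μ i) * X j) * g ∈ Jf f) (p : S) :
    (p - Polynomial.aeval (X j : S) (ev μ p)) * g ∈ Jf f := by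
  induction p using MvPolynomial.induction_on with
  | C a =>
    have : Polynomial.aeval (X j : S) (ev μ (C a)) = C a := by
      simp [ev, MvPolynomial.algebraMap_eq]
    rw [this]; simp
  | add p q hp hq =>
    rw [map_add, map_add]
    convert Ideal.add_mem _ hp hq using 1; ring
  | mul_X p i hp =>
    have hX : Polynomial.aeval (X j : S) (ev μ (X i)) = C (μ i) * X j := by
      simp [ev, MvPolynomial.algebraMap_eq]
    rw [map_mul, map_mul, hX]
    convert Ideal.add_mem _ (Ideal.mul_mem_left _ (X i) hp)
      (Ideal.mul_mem_left _ (Polynomial.aeval (X j : S) (ev μ p)) (h i)) using 1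
    ring

theorem hc_aeval (j : Fin 3) (q : Polynomial ℂ) (k : ℕ) :
    hc k (Polynomial.aeval (X j : S) q) = C (q.coeff k) * X j ^ k := by
  induction q using Polynomial.induction_on' with
  | add p q hp hq => rw [map_add, map_add, hp, hq, Polynomial.coeff_add, C_add, add_mul]
  | monomial n a =>
    rw [Polynomial.aeval_monomial, MvPolynomial.algebraMap_eq, hc_of (isHomogeneous_C_mul_X_pow a j n),
      Polynomial.coeff_monomial]
    split_ifs with h
    · rw [h]
    · simp

theorem ev_coeff {f : S} {d : ℕ} (hf : f.IsHomogeneous d) {g : S} {e : ℕ} (hge : g.IsHomogeneous e)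
    {j : Fin 3} {μ : Fin 3 → ℂ} (h : ∀ i, (X i - C (μ i) * X j) * g ∈ Jf f) {n : ℕ}
    (hn : ∀ k < n, X j ^ k * g ∉ Jf f) {p : S} (hp : p * g ∈ Jf f) :
    ∀ k < n, (ev μ p).coeff k = 0 := by
  intro k hk
  have h1 := Ideal.sub_mem _ hp (ev_sub h p)
  rw [← sub_mul, sub_sub_cancel] at h1
  have h2 := hc_mem_Jf hf h1 (k + e)
  rw [hc_mul _ hge, if_pos (by omega), Nat.add_sub_cancel, hc_aeval, mul_assoc] at h2
  exact C_mul_mem (hn k hk) h2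


theorem psi_pp (f : S) (T : Finset ℕ) (nn : ℕ → S) (w : Fin 3 ⊕ T → S) :
    psi (pp f T nn) w = ∑ i, w (Sum.inl i) * pderiv i f + ∑ e : T, w (Sum.inr e) * nn e := by
  simp [psi, Fintype.linearCombination_apply, Fintype.sum_sum_type, pp]

def sh (c : Bool) : Fin 3 := if c then 2 else 1

def ll (j : Fin 3) (μ : Fin 3 → ℂ) (c : Bool) : S := X (j + sh c) - C (μ (j + sh c)) * X j

theorem ll_hom (j : Fin 3) (μ : Fin 3 → ℂ) (c : Bool) : (ll j μ c).IsHomogeneous 1 :=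
  (isHomogeneous_X ℂ _).sub (isHomogeneous_C_mul_X _ _)

theorem sh_ne (j : Fin 3) (c : Bool) : j + sh c ≠ j := by
  revert j c; decide

theorem sh_ne' (j : Fin 3) : j + sh false ≠ j + sh true := by
  revert j; decide

/-- linear coefficient functional -/
def lin (i : Fin 3) (p : S) : ℂ := constantCoeff (pderiv i p)

theorem lin_ll (j : Fin 3) (μ : Fin 3 → ℂ) (c c' : Bool) :
    lin (j + sh c) (ll j μ c') = if c = c' then 1 else 0 := by
  have h1 : (j + sh c = j) ↔ False := iff_of_false (sh_ne j c) id
  have h2 : (j = j + sh c) ↔ False := iff_of_false (sh_ne j c).symm id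
  have h3 : (j + sh c' = j + sh c) ↔ c = c' := by revert j c c'; decide
  have h4 : (j + sh c = j + sh c') ↔ c = c' := by revert j c c'; decide
  by_cases h : c = c'
  · simp [lin, ll, pderiv_C_mul, pderiv_X, Pi.single_apply, h1, h2, h3, h4, h]
    all_goals simp_all
  · simp [lin, ll, pderiv_C_mul, pderiv_X, Pi.single_apply, h1, h2, h3, h4, h]
    all_goals simp_all

theorem lin_mul {i : Fin 3} {p q : S} (hp : constantCoeff p = 0) (hq : constantCoeff q = 0) :
    lin i (p * q) = 0 := by
  simp [lin, Derivation.leibniz, hp, hq]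

theorem ll_ne (j : Fin 3) (μ : Fin 3 → ℂ) (c : Bool) : ll j μ c ≠ 0 := by
  intro h
  have := lin_ll j μ c c
  rw [h] at this
  simp [lin] at this

theorem ev_ll {j : Fin 3} {μ : Fin 3 → ℂ} (hμ : μ j = 1) (c : Bool) : ev μ (ll j μ c) = 0 := by
  simp [ev, ll, hμ]

theorem ev_X {j : Fin 3} {μ : Fin 3 → ℂ} (hμ : μ j = 1) : ev μ (X j) = Polynomial.X := by
  simp [ev, hμ]

theorem ev_mId (μ : Fin 3 → ℂ) {r : S} (hr : r ∈ mId) : Polynomial.X ∣ ev μ r := by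
  rw [mem_mId_iff'] at hr
  obtain ⟨a, b, c, rfl⟩ := hr
  have : ∀ i, ev μ (X i) = Polynomial.X * Polynomial.C (μ i) := fun i => by
    simp [ev]
  simp only [map_add, map_mul, this, mul_assoc]
  exact dvd_add (dvd_add (Dvd.intro _ rfl) (Dvd.intro _ rfl)) (Dvd.intro _ rfl)

theorem core {f : S} {d : ℕ} (hf : f.IsHomogeneous d) (hnf : NearlyFree f) :
    ∃ (l1 l2 l3 g : S) (A B D : Fin 3 → S) (n e : ℕ), Kos2 l1 l2 ∧ Kos3 l1 l2 l3 ∧ 1 ≤ n ∧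
      l1.IsHomogeneous 1 ∧ l2.IsHomogeneous 1 ∧ l3.IsHomogeneous n ∧ l1 ≠ 0 ∧ l2 ≠ 0 ∧ l3 ≠ 0 ∧
      d - 1 ≤ 1 + e ∧ (∀ i, (A i).IsHomogeneous (1 + e - (d - 1))) ∧
      (∀ i, (B i).IsHomogeneous (1 + e - (d - 1))) ∧
      (∀ i, (D i).IsHomogeneous (n + e - (d - 1))) ∧
      ∑ i, A i * pderiv i f = l1 * g ∧ ∑ i, B i * pderiv i f = l2 * g ∧
      ∑ i, D i * pderiv i f = l3 * g ∧
      (∀ x y z : S, (∀ i, x * A i + y * B i + z * D i = 0) → x * l1 + y * l2 + z * l3 = 0 →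
        x = 0 ∧ y = 0 ∧ z = 0) ∧
      ∃ u : S, u - 1 ∈ mId ∧ ∀ r ∈ ARmod f, ∃ x y z : S,
        (∀ i, u * r i = x * A i + y * B i + z * D i) ∧ x * l1 + y * l2 + z * l3 = 0 := by
  classical
  obtain ⟨T, nn, hTne, hst, hrange⟩ := exists_T hf hnf
  choose j μ hμ hjμ using fun e : T => lin_rel hnf (hst e e.2).mem (hst e e.2).hom
  have hnn0 : ∀ e : T, nn e ≠ 0 := fun e h => (hst e e.2).nmem (by rw [h]; simp)
  set a : T := ⟨T.max' hTne, T.max'_mem hTne⟩ with ha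
  have hamax : ∀ e ∈ T, e ≤ a.1 := fun e he => T.le_max' e he
  have hex := pow_kills (hst a a.2).mem (j a)
  obtain ⟨n, hnJ, hnmin⟩ : ∃ n, X (j a) ^ n * nn a ∈ Jf f ∧ ∀ k < n, X (j a) ^ k * nn a ∉ Jf f :=
    ⟨Nat.find hex, Nat.find_spec hex, fun k hk => Nat.find_min hex hk⟩
  have hn1 : 1 ≤ n := by
    by_contra h
    obtain rfl : n = 0 := by omega
    exact (hst a a.2).nmem (by simpa using hnJ)
  have hlift : ∀ (e : T) (c : Bool), d - 1 ≤ 1 + e.1 ∧ ∃ α : Fin 3 → S,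
      (∀ i, (α i).IsHomogeneous (1 + e.1 - (d - 1))) ∧ ll (j e) (μ e) c * nn e = ∑ i, α i * pderiv i f :=
    fun e c => Jf_lift hf ((ll_hom _ _ c).mul (hst e e.2).hom) (mul_ne_zero (ll_ne _ _ c) (hnn0 e))
      (hjμ e _)
  choose hde α hαh hα using hlift
  obtain ⟨-, D, hDh, hD⟩ := Jf_lift hf ((isHomogeneous_X_pow (R := ℂ) (j a) n).mul (hst a a.2).hom)
    (mul_ne_zero (pow_ne_zero _ (X_ne_zero _)) (hnn0 a)) hnJ
  set p := pp f T nn with hp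
  let κ : Option (T × Bool) → KK p := fun o => match o with
    | none => ⟨Sum.elim (fun i => -D i) (Pi.single a (X (j a) ^ n)), by
        rw [LinearMap.mem_ker, hp, psi_pp]
        simp [Pi.single_apply, hD]⟩
    | some (e, c) => ⟨Sum.elim (fun i => -α e c i) (Pi.single e (ll (j e) (μ e) c)), by
        rw [LinearMap.mem_ker, hp, psi_pp]
        simp [Pi.single_apply, hα]⟩
  have hKJ : ∀ w : KK p, ∑ e : T, w.1 (Sum.inr e) * nn e ∈ Jf f := by
    intro w
    have h : psi (pp f T nn) w.1 = 0 := w.2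
    rw [psi_pp] at h
    rw [mem_Jf]
    refine ⟨fun i => -w.1 (Sum.inl i), ?_⟩
    simp only [neg_mul, Finset.sum_neg_distrib]
    linear_combination h
  have hsumI : ∀ (x : Option (T × Bool) → S) (e : T), (∑ o, x o • κ o).1 (Sum.inr e) =
      x none * (Pi.single a (X (j a) ^ n) : T → S) e + (x (some (e, false)) * ll (j e) (μ e) false
        + x (some (e, true)) * ll (j e) (μ e) true) := by
    intro x e
    have : ∀ e' c, (κ (some (e', c))).1 (Sum.inr e) = if e' = e then ll (j e) (μ e) c else 0 := by
      intro e' c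
      simp only [κ, Sum.elim_inr, Pi.single_apply]
      by_cases h : e' = e
      · subst h; simp
      · simp [h, Ne.symm h]
    rw [Fintype.sum_option, Fintype.sum_prod_type]
    simp only [Submodule.coe_add, Submodule.coe_smul, Submodule.coe_sum, Pi.add_apply,
      Finset.sum_apply, Pi.smul_apply, this, smul_eq_mul, Fintype.sum_bool]
    rw [Finset.sum_eq_single e]
    · simp [κ] <;> ring
    · intro b _ hb; simp [hb]
    · simp
  have hind : LinearIndependent ℂ (fun o => (mK p).mkQ (κ o)) := by
    rw [Fintype.linearIndependent_iff]
    intro c hc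
    have hz : ∑ o, (C (c o) : S) • κ o ∈ mK p := by
      rw [← Submodule.Quotient.mk_eq_zero, ← Submodule.mkQ_apply, map_sum, ← hc]
      refine Finset.sum_congr rfl fun o _ => ?_
      rw [mkQ_smul]; simp
    have van1 : ∀ w ∈ mK p, ∀ (e : T) (i : Fin 3), lin i (w.1 (Sum.inr e)) = 0 := by
      intro w hw e i
      induction hw using Submodule.smul_induction_on' with
      | smul r hr w _ =>
        exact lin_mul ((mem_mId_iff r).1 hr) (const_zero hf hst (fun e => w.1 (Sum.inr e)) (hKJ w) e)
      | add x _ y _ hx hy =>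
        simp only [lin, Submodule.coe_add, Pi.add_apply, map_add] at hx hy ⊢
        rw [hx, hy, add_zero]
    have van2 : ∀ w ∈ mK p, (ev (μ a) (w.1 (Sum.inr a))).coeff n = 0 := by
      intro w hw
      induction hw using Submodule.smul_induction_on' with
      | smul r hr w _ =>
        have h1 := ev_coeff hf (hst a a.2).hom (hjμ a) hnmin
          (max_mem hf hst (fun e => w.1 (Sum.inr e)) (hKJ w) a hamax)
        rw [← Polynomial.X_pow_dvd_iff] at h1
        have h2 := mul_dvd_mul h1 (ev_mId (μ a) hr)
        rw [← pow_succ, Polynomial.X_pow_dvd_iff] at h2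
        have h3 := h2 n (by omega)
        change (ev (μ a) (r * w.1 (Sum.inr a))).coeff n = 0
        rw [map_mul, mul_comm]; exact h3
      | add x _ y _ hx hy =>
        simp only [Submodule.coe_add, Pi.add_apply, map_add, Polynomial.coeff_add] at hx hy ⊢
        rw [hx, hy, add_zero]
    have linadd : ∀ i (p q : S), lin i (p + q) = lin i p + lin i q := by
      intro i p q; simp [lin]
    have linC : ∀ i c (p : S), lin i (C c * p) = c * lin i p := by
      intro i c p; simp [lin, pderiv_C_mul]
    have hsome : ∀ (e : T) (b : Bool), c (some (e, b)) = 0 := by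
      intro e b
      have h1 := van1 _ hz e (j e + sh b)
      rw [hsumI] at h1
      have h2 : lin (j e + sh b) ((Pi.single a (X (j a) ^ n) : T → S) e) = 0 := by
        by_cases hea : e = a
        · rw [hea, Pi.single_eq_same, lin, Derivation.leibniz_pow, pderiv_X,
            Pi.single_eq_of_ne (sh_ne (j a) b).symm]
          simp
        · rw [Pi.single_eq_of_ne hea]; simp [lin]
      simp only [linadd, linC, lin_ll, h2] at h1
      cases b <;> simpa using h1
    have hnone : c none = 0 := by
      have h1 := van2 _ hz
      rw [hsumI] at h1
      simp only [hsome, Pi.single_eq_same, C_0, zero_mul, add_zero, map_mul, map_pow, ev_X (hμ a)] at h1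
      have h2 : ev (μ a) (C (c none)) = Polynomial.C (c none) := by simp [ev]
      rw [h2, Polynomial.coeff_C_mul_X_pow] at h1
      simpa using h1
    rintro (_ | ⟨e, b⟩)
    · exact hnone
    · exact hsome e b
  have hp0 : p ≠ 0 := fun h => hnn0 a (congrFun h (Sum.inr a))
  obtain ⟨hcard, hcard2⟩ := keyA p hp0 (fun h hh => by
    rw [hrange]
    exact Isat_sat fun i => (hrange _).1 (hh i)) κ hind
  simp only [Fintype.card_option, Fintype.card_prod, Fintype.card_coe, Fintype.card_bool,
    Fintype.card_sum, Fintype.card_fin] at hcard hcard2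
  have hT1 : T.card = 1 := by
    have := hTne.card_pos
    omega
  obtain ⟨hLI, u, hu, hspan⟩ := hcard2 (by omega)
  have hsub : ∀ e : T, e = a := fun e =>
    Subtype.ext (Finset.card_le_one.1 hT1.le e.1 e.2 a.1 a.2)
  have hsumL : ∀ (x : Option (T × Bool) → S) (i : Fin 3), (∑ o, x o • κ o).1 (Sum.inl i) =
      -(x (some (a, false)) * α a false i + x (some (a, true)) * α a true i + x none * D i) := by
    intro x i
    rw [Fintype.sum_option, Fintype.sum_prod_type, Finset.sum_eq_single a]
    · simp [κ] <;> ring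
    · intro b _ hb; exact absurd (hsub b) hb
    · simp
  refine ⟨ll (j a) (μ a) false, ll (j a) (μ a) true, X (j a) ^ n, nn a, α a false, α a true, D, n, a.1,
    kos_lin2 (sh_ne' _) (sh_ne _ _) (sh_ne _ _) _, kos_lin3 (sh_ne' _) (sh_ne _ _) (sh_ne _ _) _ _, hn1,
    ll_hom _ _ _, ll_hom _ _ _, isHomogeneous_X_pow _ _, ll_ne _ _ _, ll_ne _ _ _,
    pow_ne_zero _ (X_ne_zero _), hde a false, hαh a false, hαh a true, hDh,
    (hα a false).symm, (hα a true).symm, hD.symm, ?_, u, hu, ?_⟩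
  · intro x y z h1 h2
    let X' : Option (T × Bool) → S := fun o => match o with
      | none => z
      | some (_, false) => x
      | some (_, true) => y
    have h3 := Fintype.linearIndependent_iff.1 hLI X' (by
      apply Subtype.ext
      funext k
      rcases k with i | e
      · rw [hsumL]
        simp only [X', Submodule.coe_zero, Pi.zero_apply]
        linear_combination -(h1 i)
      · rw [hsumI, hsub e, Pi.single_eq_same]
        simp only [X', Submodule.coe_zero, Pi.zero_apply]
        linear_combination h2)
    exact ⟨h3 (some (a, false)), h3 (some (a, true)), h3 none⟩
  · intro r hr
    have hr' : ∑ i, r i * pderiv i f = 0 := hr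
    let w : KK p := ⟨Sum.elim r 0, by
      rw [LinearMap.mem_ker, hp, psi_pp]
      simpa using hr'⟩
    have hw := hspan w
    rw [Submodule.mem_span_range_iff_exists_fun] at hw
    obtain ⟨x, hx⟩ := hw
    refine ⟨-x (some (a, false)), -x (some (a, true)), -x none, fun i => ?_, ?_⟩
    · have h1 := congrFun (congrArg Subtype.val hx) (Sum.inl i)
      rw [hsumL] at h1
      have h2 : (u • w).1 (Sum.inl i) = u * r i := rfl
      rw [h2] at h1
      linear_combination -h1
    · have h1 := congrFun (congrArg Subtype.val hx) (Sum.inr a)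
      rw [hsumI, Pi.single_eq_same] at h1
      have h2 : (u • w).1 (Sum.inr a) = u * 0 := rfl
      rw [h2, mul_zero] at h1
      linear_combination -h1


theorem sum_hc_ge (p : S) {N : ℕ} (hN : p.totalDegree < N) : p = ∑ k ∈ Finset.range N, hc k p := by
  conv_lhs => rw [← sum_homogeneousComponent p]
  apply Finset.sum_subset
  · intro k hk
    simp only [Finset.mem_range] at hk ⊢
    omega
  · intro k _ hk
    simp only [Finset.mem_range] at hk
    exact homogeneousComponent_eq_zero k p (by omega)

theorem hom_mem {f : S} {r : Fin 3 → (Fin 3 → S)} {dd : Fin 3 → ℕ} (hr : ∀ j, IsHomRel (r j) (dd j))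
    {u : S} (hu : u - 1 ∈ mId) {s : Fin 3 → S} {k : ℕ} (hs : IsHomRel s k) (c : Fin 3 → S)
    (h : ∀ i, u * s i = ∑ j, c j * r j i) : s ∈ Submodule.span S (Set.range r) := by
  rw [Submodule.mem_span_range_iff_exists_fun]
  refine ⟨fun j => if dd j ≤ k then hc (k - dd j) (c j) else 0, ?_⟩
  funext i
  have h1 := congrArg (hc k) (h i)
  have hu1 : constantCoeff u = 1 := by
    rw [mem_mId_iff, map_sub, map_one, sub_eq_zero] at hu
    exact hu
  rw [hc_mul u (mem_Sgr.1 (hs i)), if_pos le_rfl, Nat.sub_self, map_sum, hc,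
    homogeneousComponent_zero, ← constantCoeff_eq, hu1, C_1, one_mul] at h1
  rw [h1]
  simp only [Finset.sum_apply, Pi.smul_apply, smul_eq_mul]
  refine Finset.sum_congr rfl fun j _ => ?_
  have := hc_mul (c j) (mem_Sgr.1 (hr j i)) k
  rw [hc] at this
  rw [this]
  split_ifs <;> simp

theorem AR_hc {f : S} {d : ℕ} (hf : f.IsHomogeneous d) {r : Fin 3 → S} (hr : r ∈ ARmod f) (k : ℕ) :
    (fun i => hc k (r i)) ∈ ARmod f := by
  have h : ∑ i, r i * pderiv i f = 0 := hr
  have h2 := hc_sum hf r (k + (d - 1))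
  rw [h, map_zero, if_pos (by omega), Nat.add_sub_cancel] at h2
  exact h2.symm

theorem nonred {r : Fin 3 → (Fin 3 → S)} {v : Fin 3 → S}
    (hk : LinearMap.ker (syzMap r) ≤ Submodule.span S {v}) (hv : ∀ j, constantCoeff (v j) = 0)
    (j : Fin 3) : r j ∉ Submodule.span S (r '' {k | k ≠ j}) := by
  intro h
  rw [Submodule.mem_span_image_iff_exists_fun] at h
  obtain ⟨t, ht, c, hc⟩ := h
  let u : Fin 3 → S := fun k => if hk : k ∈ t then c ⟨k, hk⟩ else 0
  have hu : ∑ k, u k • r k = r j := by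
    rw [← hc, ← Finset.sum_subset (Finset.subset_univ t), ← Finset.sum_coe_sort]
    · simp [u]
    · intro k _ hk
      simp [u, hk]
  have hj : u j = 0 := by
    have : j ∉ t := fun hh => ht hh rfl
    simp [u, this]
  clear_value u
  have hs1 : syzMap r u = r j := hu
  have hs2 : syzMap r (Pi.single j 1) = r j := by
    have h0 : syzMap r (Pi.single j 1) = ∑ k, (Pi.single j 1 : Fin 3 → S) k • r k := rfl
    rw [h0, Finset.sum_eq_single j]
    · rw [Pi.single_eq_same, one_smul]
    · intro b _ hb
      rw [Pi.single_eq_of_ne hb, zero_smul]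
    · intro h
      exact absurd (Finset.mem_univ j) h
  have hmem : (u - Pi.single j 1) ∈ LinearMap.ker (syzMap r) := by
    rw [LinearMap.mem_ker, map_sub, hs1, hs2, sub_self]
  obtain ⟨a, ha⟩ := Submodule.mem_span_singleton.1 (hk hmem)
  have h1 := congrArg constantCoeff (congrFun ha j)
  rw [Pi.smul_apply, Pi.sub_apply, smul_eq_mul, map_mul, map_sub, hj, hv j, Pi.single_eq_same] at h1
  simp at h1

theorem main_res (f : S) (d : ℕ) (hhom : f.IsHomogeneous d) (hnf : NearlyFree f) :
    ∃ (d1 d2 d3 : ℕ) (b : ℤ), d1 ≤ d2 ∧ d2 ≤ d3 ∧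
      HasResolution f d ![d1, d2, d3] b := by
  obtain ⟨l1, l2, l3, g, A, B, D, n, e, K2, K3, hn, h1, h2, h3, n1, n2, n3, hde, hA, hB, hD,
    eA, eB, eD, LI, u, hu, hsp⟩ := core hhom hnf
  obtain ⟨k, hk⟩ : ∃ k, 1 + e = (d - 1) + k := ⟨1 + e - (d - 1), by omega⟩
  have e1 : 1 + e - (d - 1) = k := by omega
  rw [e1] at hA hB
  have hmul : ∀ {p q : S} {a b c : ℕ}, p.IsHomogeneous a → q.IsHomogeneous b → a + b = c →
      (p * q).IsHomogeneous c := fun hp hq h => h ▸ hp.mul hq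
  let r : Fin 3 → (Fin 3 → S) := ![fun i => l2 * A i - l1 * B i, fun i => l3 * A i - l1 * D i,
    fun i => l3 * B i - l2 * D i]
  let v : Fin 3 → S := ![l3, -l2, l1]
  have hAR : ∀ j, r j ∈ ARmod f := by
    rw [Fin.sum_univ_three] at eA eB eD
    intro j
    change ∑ i, r j i * pderiv i f = 0
    rw [Fin.sum_univ_three]
    fin_cases j
    · change (l2 * A 0 - l1 * B 0) * _ + (l2 * A 1 - l1 * B 1) * _ + (l2 * A 2 - l1 * B 2) * _ = 0
      linear_combination l2 * eA - l1 * eB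
    · change (l3 * A 0 - l1 * D 0) * _ + (l3 * A 1 - l1 * D 1) * _ + (l3 * A 2 - l1 * D 2) * _ = 0
      linear_combination l3 * eA - l1 * eD
    · change (l3 * B 0 - l2 * D 0) * _ + (l3 * B 1 - l2 * D 1) * _ + (l3 * B 2 - l2 * D 2) * _ = 0
      linear_combination l3 * eB - l2 * eD
  have hH : ∀ j, IsHomRel (r j) ((![1 + k, n + k, n + k] : Fin 3 → ℕ) j) := by
    intro j i
    rw [mem_Sgr]
    fin_cases j
    · exact (hmul h2 (hA i) rfl).sub (hmul h1 (hB i) rfl)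
    · exact (hmul h3 (hA i) rfl).sub (hmul h1 (hD i) (by omega))
    · exact (hmul h3 (hB i) rfl).sub (hmul h2 (hD i) (by omega))
  have hker : LinearMap.ker (syzMap r) = Submodule.span S {v} := by
    apply le_antisymm
    · intro w hw
      have hw' : ∑ j, w j • r j = 0 := hw
      rw [Fin.sum_univ_three] at hw'
      obtain ⟨hx, hy, hz⟩ := LI (w 0 * l2 + w 1 * l3) (-w 0 * l1 + w 2 * l3) (-w 1 * l1 - w 2 * l2)
        (fun i => by
          have h : w 0 * (l2 * A i - l1 * B i) + w 1 * (l3 * A i - l1 * D i) +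
            w 2 * (l3 * B i - l2 * D i) = 0 := congrFun hw' i
          linear_combination h) (by ring)
      obtain ⟨t, ht1, ht2⟩ := K2 (w 1) (-w 2) (by linear_combination -hz)
      have h0 : w 0 = -t * l3 := by
        apply mul_right_cancel₀ n2
        linear_combination hx - l3 * ht1
      rw [Submodule.mem_span_singleton]
      refine ⟨-t, ?_⟩
      funext j
      fin_cases j
      · exact h0.symm
      · change -t * -l2 = w 1
        linear_combination -ht1
      · change -t * l1 = w 2
        linear_combination ht2
    · rw [Submodule.span_singleton_le_iff_mem, LinearMap.mem_ker]
      change ∑ j, v j • r j = 0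
      rw [Fin.sum_univ_three]
      funext i
      change l3 * (l2 * A i - l1 * B i) + -l2 * (l3 * A i - l1 * D i) +
            l1 * (l3 * B i - l2 * D i) = 0
      ring
  have hcc : ∀ {p : S} {m : ℕ}, p.IsHomogeneous m → 1 ≤ m → constantCoeff p = 0 := by
    intro p m hp hm
    rw [constantCoeff_eq]
    apply hp.coeff_eq_zero
    simp
    omega
  refine ⟨1 + k, n + k, n + k, (1 + k + n : ℤ) - d + 1, by omega, le_rfl, r, hAR, hH, ?_,
    nonred hker.le ?_, v, ?_, ?_, hker⟩
  · apply le_antisymm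
    · rw [Submodule.span_le]
      rintro _ ⟨j, rfl⟩
      exact hAR j
    · intro s hs
      have hsum : s = ∑ m ∈ Finset.range (∑ i, (s i).totalDegree + 1), fun i => hc m (s i) := by
        funext i
        rw [Finset.sum_apply]
        apply sum_hc_ge
        have := Finset.single_le_sum (f := fun i => (s i).totalDegree) (fun _ _ => Nat.zero_le _)
          (Finset.mem_univ i)
        omega
      rw [hsum]
      refine Submodule.sum_mem _ fun m _ => ?_
      obtain ⟨x, y, z, hxyz, hrel⟩ := hsp _ (AR_hc hhom hs m)
      obtain ⟨A', B', C', hp, hq, hr⟩ := K3 x y z (by linear_combination hrel)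
      refine hom_mem (f := f) hH hu (k := m) (fun i => homogeneousComponent_isHomogeneous m (s i))
        ![C', -B', A'] fun i => ?_
      rw [Fin.sum_univ_three, hxyz i]
      change _ = C' * (l2 * A i - l1 * B i) + -B' * (l3 * A i - l1 * D i) +
            A' * (l3 * B i - l2 * D i)
      rw [hp, hq, hr]
      ring
  · intro j
    fin_cases j
    · exact hcc h3 hn
    · exact hcc h2.neg le_rfl
    · exact hcc h1 le_rfl
  · intro h
    exact n3 (congrFun h 0)
  · intro j
    fin_cases j
    · exact ⟨n, by change (n : ℤ) = _ - ((1 + k : ℕ) : ℤ) + _ - 1; push_cast; ring, h3⟩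
    · exact ⟨1, by change ((1 : ℕ) : ℤ) = _ - ((n + k : ℕ) : ℤ) + _ - 1; push_cast; ring, h2.neg⟩
    · exact ⟨1, by change ((1 : ℕ) : ℤ) = _ - ((n + k : ℕ) : ℤ) + _ - 1; push_cast; ring, h1⟩

theorem stmt0 (f : S) (d : ℕ) (hhom : f.IsHomogeneous d) (hred : Squarefree f)
    (hnc : ¬ IsConeOfLines f) (hnf : NearlyFree f) :
    ∃ (d1 d2 d3 : ℕ) (b : ℤ), d1 ≤ d2 ∧ d2 ≤ d3 ∧
      HasResolution f d ![d1, d2, d3] b := by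
  exact main_res f d hhom hnf

end
end

section
/- Let d ≥ 1 and d1, d2, d3, b be integers and τ a rational number. Suppose that for all sufficiently large integers j one has (j+2)(j+1)/2 − 3(j−d+3)(j−d+2)/2 + Σ_{i=1,2,3} (j−d_i−d+3)(j−d_i−d+2)/2 − (j−b−2d+4)(j−b−2d+3)/2 = τ. Then b = d1 + d2 + d3 − 2(d−1) and τ = (d−1)(d1+d2+d3) − (d1·d2 + d1·d3 + d2·d3). -/
open MvPolynomial

noncomputable section

theorem stmt2 (d : ℤ) (hd : 1 ≤ d) (d1 d2 d3 b : ℤ) (τ : ℚ)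
    (h : ∃ N : ℤ, ∀ j : ℤ, N ≤ j →
      ((j : ℚ) + 2) * ((j : ℚ) + 1) / 2
        - 3 * (((j : ℚ) - d + 3) * ((j : ℚ) - d + 2) / 2)
        + ((((j : ℚ) - d1 - d + 3) * ((j : ℚ) - d1 - d + 2) / 2)
            + (((j : ℚ) - d2 - d + 3) * ((j : ℚ) - d2 - d + 2) / 2)
            + (((j : ℚ) - d3 - d + 3) * ((j : ℚ) - d3 - d + 2) / 2))
        - (((j : ℚ) - b - 2 * d + 4) * ((j : ℚ) - b - 2 * d + 3) / 2) = τ) :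
    b = d1 + d2 + d3 - 2 * (d - 1) ∧
      τ = (((d - 1) * (d1 + d2 + d3) - (d1 * d2 + d1 * d3 + d2 * d3) : ℤ) : ℚ) := by
  obtain ⟨N, hN⟩ := h
  have h0 := hN N le_rfl
  have h1 := hN (N + 1) (by omega)
  push_cast at h1
  have hb : (b : ℚ) = d1 + d2 + d3 - 2 * (d - 1) := by linarith
  refine ⟨by exact_mod_cast hb, ?_⟩
  push_cast
  rw [hb] at h0
  rw [← h0]
  ring

end
end

section
/- Suppose the Milnor algebra M(f) of a reduced plane curve C : f = 0 of degree d admits a minimal graded free resolution 0 → S(−b−2(d−1)) → ⊕_{i=1,2,3} S(−d_i−(d−1)) → S(−d+1)³ → S with d1 ≤ d2 ≤ d3; equivalently, AR(f) is generated by three homogeneous relations r1, r2, r3 of degrees d1 ≤ d2 ≤ d3 none of which lies in the submodule generated by the other two, and the syzygy module among r1, r2, r3 is free of rank one generated by a homogeneous triple (v1,v2,v3) with deg v_i = b − d_i + d − 1. Then: (i) d1 + d2 ≥ d; (ii) b = d1 + d2 + d3 − 2(d−1); (iii) τ(C) = (d−1)(d1+d2+d3) − (d1·d2 + d1·d3 +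 d2·d3); (iv) the minimal degree of a nonzero element of AR(f) is d1; and (v) st(f) = b + 2d − 4, that is, m(f)_k = τ(C) for all k ≥ b+2d−4 while m(f)_{b+2d−5} = τ(C) + 1. -/
open MvPolynomial

noncomputable section

open MvPolynomial in
theorem aux_finrank_Sgr (n : ℕ) : Module.finrank ℂ (Sgr n) = (n + 2).choose 2 := by
  have h1 : Sgr n = restrictSupport ℂ {d : Fin 3 →₀ ℕ | d.degree = n} :=
    homogeneousSubmodule_eq_finsupp_supported (Fin 3) ℂ n
  have h2 : {d : Fin 3 →₀ ℕ | d.degree = n} =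
      ((Finset.finsuppAntidiag (Finset.univ : Finset (Fin 3)) n : Finset (Fin 3 →₀ ℕ)) : Set _) := by
    ext d
    simp [Finset.mem_finsuppAntidiag, Finsupp.degree_eq_sum]
  rw [h1, h2]
  rw [Module.finrank_eq_card_basis (basisRestrictSupport ℂ _)]
  simp [Finset.card_finsuppAntidiag_nat_eq_choose]
  rw [add_comm]
  exact Nat.choose_symm_add

instance aux_fin_Sgr (n : ℕ) : Module.Finite ℂ (Sgr n) :=
  Module.Finite.iff_fg.mpr (homogeneousSubmodule_fg (Fin 3) ℂ n)

/-- integer graded piece -/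
def GG (n : ℤ) : Submodule ℂ S := if 0 ≤ n then Sgr n.toNat else ⊥

/-- integer graded component -/
def gcmp (n : ℤ) : S →ₗ[ℂ] S := if 0 ≤ n then homogeneousComponent n.toNat else 0

theorem GG_nat (n : ℕ) : GG (n : ℤ) = Sgr n := by simp [GG]

theorem GG_neg (n : ℤ) (h : n < 0) : GG n = ⊥ := by simp [GG, h]

instance aux_fin_GG (n : ℤ) : Module.Finite ℂ (GG n) := by
  rcases lt_or_ge n 0 with h | h
  · rw [GG_neg n h]; infer_instance
  · lift n to ℕ using h
    rw [GG_nat]; infer_instance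

theorem finrank_GG (n : ℤ) (h : -2 ≤ n) :
    2 * (Module.finrank ℂ (GG n) : ℤ) = (n + 1) * (n + 2) := by
  rcases lt_or_ge n 0 with h0 | h0
  · rw [GG_neg n h0]
    have : n = -1 ∨ n = -2 := by omega
    rcases this with rfl | rfl <;> simp
  · lift n to ℕ using h0
    rw [GG_nat, aux_finrank_Sgr, Nat.choose_two_right]
    have : (n + 2) * (n + 2 - 1) = (n+1) * (n + 2) := by
      simp [mul_comm]
    rw [this]
    have h2 : 2 ∣ (n + 1) * (n + 2) := (Nat.even_mul_succ_self (n+1)).two_dvd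
    have := Nat.mul_div_cancel' h2
    exact_mod_cast this

theorem gcmp_mem (n : ℤ) (a : S) : gcmp n a ∈ GG n := by
  rcases lt_or_ge n 0 with h0 | h0
  · simp [gcmp, GG, not_le.mpr h0]
  · simp only [gcmp, GG, h0, if_true]
    exact homogeneousComponent_mem _ _

theorem gcmp_of_mem (k : ℤ) (m : ℕ) (a : S) (h : a ∈ Sgr m) :
    gcmp k a = if k = m then a else 0 := by
  rcases lt_or_ge k 0 with h0 | h0
  · rw [if_neg (by omega)]; simp [gcmp, not_le.mpr h0]
  · lift k to ℕ using h0
    simp only [gcmp, Nat.cast_nonneg, if_true, Int.toNat_natCast, Nat.cast_inj]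
    rw [homogeneousComponent_of_mem h]
    
theorem gcmp_of_mem_GG (k : ℤ) (a : S) (h : a ∈ GG k) : gcmp k a = a := by
  rcases lt_or_ge k 0 with h0 | h0
  · simp [GG_neg k h0] at h; simp [h]
  · lift k to ℕ using h0
    rw [GG_nat] at h
    rw [gcmp_of_mem k k a h]; simp

theorem GG_mul (k : ℤ) (m : ℕ) (a b : S) (ha : a ∈ GG k) (hb : b ∈ Sgr m) :
    a * b ∈ GG (k + m) := by
  rcases lt_or_ge k 0 with h0 | h0
  · simp [GG_neg k h0] at ha; simp [ha]
  · lift k to ℕ using h0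
    rw [GG_nat] at ha
    rw [← Nat.cast_add, GG_nat]
    exact IsHomogeneous.mul ha hb

theorem gcmp_mul (k : ℤ) (m : ℕ) (a b : S) (hb : b ∈ Sgr m) :
    gcmp k (a * b) = gcmp (k - m) a * b := by
  have key : ∀ i : ℕ, ∀ a ∈ Sgr i, gcmp k (a * b) = gcmp (k - m) a * b := by
    intro i a ha
    have : a * b ∈ Sgr (i + m) := IsHomogeneous.mul ha hb
    rw [gcmp_of_mem _ _ _ this, gcmp_of_mem _ _ _ ha]
    by_cases h : k = i + m
    · rw [if_pos (by push_cast; exact h), if_pos (by omega)]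
    · rw [if_neg (by push_cast; exact h), if_neg (by omega), zero_mul]
  rw [← sum_homogeneousComponent a, Finset.sum_mul, map_sum, map_sum, Finset.sum_mul]
  exact Finset.sum_congr rfl fun i _ => key i _ (homogeneousComponent_mem _ _)

/-- product of graded pieces -/
def PP (n : Fin 3 → ℤ) : Submodule ℂ (Fin 3 → S) := Submodule.pi Set.univ (fun j => GG (n j))

theorem mem_PP (n : Fin 3 → ℤ) (x : Fin 3 → S) : x ∈ PP n ↔ ∀ j, x j ∈ GG (n j) := by
  simp [PP, Submodule.mem_pi]

def PPequiv (n : Fin 3 → ℤ) : PP n ≃ₗ[ℂ] (∀ j, GG (n j)) where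
  toFun x j := ⟨x.1 j, (mem_PP n x.1).1 x.2 j⟩
  invFun y := ⟨fun j => (y j).1, (mem_PP n _).2 fun j => (y j).2⟩
  left_inv x := rfl
  right_inv y := rfl
  map_add' x y := rfl
  map_smul' x y := rfl

instance aux_fin_PP (n : Fin 3 → ℤ) : Module.Finite ℂ (PP n) :=
  Module.Finite.equiv (PPequiv n).symm

theorem finrank_PP (n : Fin 3 → ℤ) :
    Module.finrank ℂ (PP n) = ∑ j, Module.finrank ℂ (GG (n j)) := by
  rw [(PPequiv n).finrank_eq, Module.finrank_pi_fintype]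

theorem rank_null {V W : Type*} [AddCommGroup V] [Module ℂ V] [AddCommGroup W] [Module ℂ W]
    (g : V →ₗ[ℂ] W) (A : Submodule ℂ V) [Module.Finite ℂ A] :
    Module.finrank ℂ (A.map g) + Module.finrank ℂ (A ⊓ LinearMap.ker g : Submodule ℂ V)
      = Module.finrank ℂ A := by
  have h := LinearMap.finrank_range_add_finrank_ker (g.domRestrict A)
  rw [LinearMap.range_domRestrict] at h
  have h2 : (LinearMap.ker (g.domRestrict A)).map A.subtype = A ⊓ LinearMap.ker g := by
    ext x; simp [LinearMap.mem_ker, and_comm]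
  rw [← h2, Submodule.finrank_map_subtype_eq]
  exact h


theorem sum_gcmp (k : ℤ) (n : Fin 3 → ℕ) (a b : Fin 3 → S) (hb : ∀ j, b j ∈ Sgr (n j)) :
    gcmp k (∑ j, a j * b j) = ∑ j, gcmp (k - n j) (a j) * b j := by
  rw [map_sum]
  exact Finset.sum_congr rfl fun j _ => gcmp_mul k _ _ _ (hb j)

theorem eqnMap_apply (f : S) (a : Fin 3 → S) : eqnMap f a = ∑ i, a i * pderiv i f := rfl

theorem syzMap_apply (r : Fin 3 → (Fin 3 → S)) (u : Fin 3 → S) (i : Fin 3) :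
    syzMap r u i = ∑ j, u j * r j i := by
  simp [syzMap]

theorem range_eqnMap (f : S) : LinearMap.range (eqnMap f) = Jf f := by
  ext x
  rw [Jf, Ideal.span, Submodule.mem_span_triple, LinearMap.mem_range]
  constructor
  · rintro ⟨a, rfl⟩
    exact ⟨a 0, a 1, a 2, by simp [eqnMap_apply, Fin.sum_univ_three]⟩
  · rintro ⟨a, b, c, rfl⟩
    exact ⟨![a, b, c], by simp [eqnMap_apply, Fin.sum_univ_three]⟩

theorem range_syzMap (r : Fin 3 → (Fin 3 → S)) :
    LinearMap.range (syzMap r) = Submodule.span S (Set.range r) := by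
  ext x
  rw [Submodule.mem_span_range_iff_exists_fun, LinearMap.mem_range]
  rfl

/-- graded generation -/
theorem graded_gen (r : Fin 3 → (Fin 3 → S)) (dd : Fin 3 → ℕ) (hr : ∀ j, IsHomRel (r j) (dd j))
    (m : ℤ) (x u : Fin 3 → S) (hx : ∀ i, x i ∈ GG m) (hu : syzMap r u = x) :
    syzMap r (fun j => gcmp (m - dd j) (u j)) = x := by
  ext1 i
  rw [syzMap_apply, ← sum_gcmp m dd u (fun j => r j i) (fun j => hr j i), ← syzMap_apply, hu]
  exact gcmp_of_mem_GG _ _ (hx i)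

theorem hilb (f : S) (e : ℕ) (hf : ∀ i, pderiv i f ∈ Sgr e) (dd : Fin 3 → ℕ)
    (r : Fin 3 → (Fin 3 → S)) (hr : ∀ j, IsHomRel (r j) (dd j))
    (hspan : Submodule.span S (Set.range r) = ARmod f)
    (v : Fin 3 → S) (hv0 : v ≠ 0) (vd : Fin 3 → ℕ) (hvd : ∀ j, v j ∈ Sgr (vd j)) (c : ℤ)
    (hc : ∀ j, (vd j : ℤ) + dd j = c)
    (hker : LinearMap.ker (syzMap r) = Submodule.span S {v}) (k : ℕ) :
    (mdim f k : ℤ) = Module.finrank ℂ (GG k) - 3 * Module.finrank ℂ (GG (k - e))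
      + ∑ j, (Module.finrank ℂ (GG (k - e - dd j)) : ℤ) - Module.finrank ℂ (GG (k - e - c)) := by
  have e0 := rank_null (quotC f) (GG k)
  have e1 := rank_null ((eqnMap f).restrictScalars ℂ) (PP fun _ => (k : ℤ) - e)
  have e2 := rank_null ((syzMap r).restrictScalars ℂ) (PP fun j => (k : ℤ) - e - dd j)
  have e3 := rank_null ((LinearMap.toSpanSingleton S (Fin 3 → S) v).restrictScalars ℂ)
    (GG ((k : ℤ) - e - c))
  have i0 : (GG k).map (quotC f) = Msub f k := by rw [GG_nat]; rfl
  have i1 : (PP fun _ => (k : ℤ) - e).map ((eqnMap f).restrictScalars ℂ) =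
      GG k ⊓ LinearMap.ker (quotC f) := by
    ext x
    simp only [Submodule.mem_map, mem_PP, Submodule.mem_inf, LinearMap.mem_ker, quotC,
      LinearMap.restrictScalars_apply, Submodule.mkQ_apply, Submodule.Quotient.mk_eq_zero]
    constructor
    · rintro ⟨a, ha, rfl⟩
      refine ⟨?_, ?_⟩
      · rw [eqnMap_apply]
        refine Submodule.sum_mem _ fun i _ => ?_
        have := GG_mul _ _ _ _ (ha i) (hf i)
        rwa [sub_add_cancel] at this
      · rw [← range_eqnMap]; exact ⟨a, rfl⟩
    · rintro ⟨hx, hJ⟩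
      rw [← range_eqnMap] at hJ
      obtain ⟨a, rfl⟩ := hJ
      refine ⟨fun i => gcmp (k - e) (a i), fun i => gcmp_mem _ _, ?_⟩
      rw [eqnMap_apply, ← sum_gcmp k (fun _ => e) a _ hf]
      exact gcmp_of_mem_GG _ _ hx
  have i2 : (PP fun j => (k : ℤ) - e - dd j).map ((syzMap r).restrictScalars ℂ) =
      (PP fun _ => (k : ℤ) - e) ⊓ LinearMap.ker ((eqnMap f).restrictScalars ℂ) := by
    have hk : ∀ x, eqnMap f x = 0 ↔ x ∈ LinearMap.range (syzMap r) := by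
      intro x
      rw [range_syzMap, hspan]; rfl
    ext x
    simp only [Submodule.mem_map, mem_PP, Submodule.mem_inf, LinearMap.mem_ker,
      LinearMap.restrictScalars_apply, hk]
    constructor
    · rintro ⟨a, ha, rfl⟩
      refine ⟨fun i => ?_, ⟨a, rfl⟩⟩
      rw [syzMap_apply]
      refine Submodule.sum_mem _ fun j _ => ?_
      have := GG_mul _ _ _ _ (ha j) (hr j i)
      rwa [sub_add_cancel] at this
    · rintro ⟨hx, a, ha⟩
      exact ⟨_, fun j => gcmp_mem _ _, graded_gen r dd hr _ x a hx ha⟩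
  have i3 : (GG ((k : ℤ) - e - c)).map
        ((LinearMap.toSpanSingleton S (Fin 3 → S) v).restrictScalars ℂ) =
      (PP fun j => (k : ℤ) - e - dd j) ⊓ LinearMap.ker ((syzMap r).restrictScalars ℂ) := by
    have hk : ∀ x, syzMap r x = 0 ↔ ∃ a : S, a • v = x := by
      intro x
      rw [← Submodule.mem_span_singleton, ← hker]; rfl
    have hd : ∀ j, (k : ℤ) - e - dd j - vd j = k - e - c := by
      intro j; have := hc j; omega
    ext x
    simp only [Submodule.mem_map, mem_PP, Submodule.mem_inf, LinearMap.mem_ker,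
      LinearMap.restrictScalars_apply, hk, LinearMap.toSpanSingleton_apply]
    constructor
    · rintro ⟨a, ha, rfl⟩
      refine ⟨fun j => ?_, ⟨a, rfl⟩⟩
      rw [← hd j] at ha
      have := GG_mul _ _ _ _ ha (hvd j)
      rwa [sub_add_cancel] at this
    · rintro ⟨hx, a, rfl⟩
      refine ⟨gcmp (k - e - c) a, gcmp_mem _ _, ?_⟩
      ext1 j
      have := gcmp_mul (k - e - dd j) _ a _ (hvd j)
      rw [hd j] at this
      rw [Pi.smul_apply, smul_eq_mul, ← this]
      exact gcmp_of_mem_GG _ _ (hx j)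
  have i4 : GG ((k : ℤ) - e - c) ⊓ LinearMap.ker
      ((LinearMap.toSpanSingleton S (Fin 3 → S) v).restrictScalars ℂ) = ⊥ := by
    rw [eq_bot_iff]
    rintro x ⟨-, hx⟩
    have hx' : x • v = 0 := hx
    simpa [hv0] using hx'
  rw [i0, ← i1] at e0
  rw [← i2] at e1
  rw [← i3] at e2
  rw [i4, finrank_bot] at e3
  rw [finrank_PP] at e1 e2
  simp only [Finset.sum_const, Finset.card_univ, Fintype.card_fin, smul_eq_mul] at e1
  rw [mdim]
  zify at e0 e1 e2 e3
  linarith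

theorem mem_span_of_unit (r : Fin 3 → (Fin 3 → S)) (u : Fin 3 → S) (j : Fin 3)
    (hu : syzMap r u = 0) (hj : IsUnit (u j)) : r j ∈ Submodule.span S (r '' {k | k ≠ j}) := by
  have h : ∑ k, u k • r k = 0 := hu
  rw [← Finset.add_sum_erase _ _ (Finset.mem_univ j)] at h
  have h2 : u j • r j ∈ Submodule.span S (r '' {k | k ≠ j}) := by
    rw [eq_neg_of_add_eq_zero_left h]
    refine Submodule.neg_mem _ (Submodule.sum_mem _ fun k hk => Submodule.smul_mem _ _ ?_)
    exact Submodule.subset_span ⟨k, (Finset.mem_erase.mp hk).1, rfl⟩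
  obtain ⟨w, hw⟩ := hj
  rw [← hw] at h2
  have := Submodule.smul_mem _ (↑w⁻¹ : S) h2
  simpa [smul_smul] using this

theorem unit_of_deg_zero (a : S) (ha : a ∈ Sgr 0) (h0 : a ≠ 0) : IsUnit a := by
  have h1 := gcmp_of_mem 0 0 a ha
  have : a = C (coeff 0 a) := by
    simpa [gcmp] using h1.symm
  rw [this] at h0 ⊢
  refine IsUnit.map C (isUnit_iff_ne_zero.mpr ?_)
  intro h; rw [h] at h0; simp at h0

theorem vdeg_pos (f : S) (hf0 : f ≠ 0) (dd : Fin 3 → ℕ)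
    (r : Fin 3 → (Fin 3 → S)) (hr : ∀ j, IsHomRel (r j) (dd j)) (hrA : ∀ j, r j ∈ ARmod f)
    (hspan : Submodule.span S (Set.range r) = ARmod f)
    (hmin : ∀ j, r j ∉ Submodule.span S (r '' {k | k ≠ j}))
    (v : Fin 3 → S) (hv0 : v ≠ 0) (vd : Fin 3 → ℕ) (hvd : ∀ j, v j ∈ Sgr (vd j))
    (hker : LinearMap.ker (syzMap r) = Submodule.span S {v}) : vd 2 ≠ 0 := by
  intro h2
  have hsv : syzMap r v = 0 := by
    rw [← LinearMap.mem_ker, hker]; exact Submodule.mem_span_singleton_self v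
  have hnu : ∀ j, ¬ IsUnit (v j) := fun j hj => hmin j (mem_span_of_unit r v j hsv hj)
  have hv2 : v 2 = 0 := by
    by_contra h
    exact hnu 2 (unit_of_deg_zero _ (h2 ▸ hvd 2) h)
  have hrel : ∀ i, v 0 * r 0 i + v 1 * r 1 i = 0 := by
    intro i
    have := congrFun hsv i
    rw [syzMap_apply, Fin.sum_univ_three, hv2] at this
    simpa using this
  have hr0 : ∀ j, r j ≠ 0 := fun j h => hmin j (h ▸ Submodule.zero_mem _)
  have hv1 : v 1 ≠ 0 := by
    intro h1
    have hv00 : v 0 ≠ 0 := by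
      intro h00; apply hv0; ext1 j; fin_cases j <;> simp [h00, h1, hv2]
    apply hr0 0
    ext1 i
    have := hrel i
    simpa [h1, hv00] using this
  have hd1 : vd 1 ≠ 0 := fun h => hnu 1 (unit_of_deg_zero _ (h ▸ hvd 1) hv1)
  have hcop : IsRelPrime (v 1) (v 0) := by
    rintro g ⟨a1, h1⟩ ⟨a0, h0⟩
    have hg : g ≠ 0 := by rintro rfl; simp at h1; exact hv1 h1
    have hvw : v = g • ![a0, a1, 0] := by
      ext1 j; fin_cases j <;> simp [h0, h1, hv2]
    have hw : (![a0, a1, 0] : Fin 3 → S) ∈ LinearMap.ker (syzMap r) := by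
      rw [LinearMap.mem_ker]
      rw [hvw, map_smul] at hsv
      exact (smul_eq_zero.mp hsv).resolve_left hg
    rw [hker, Submodule.mem_span_singleton] at hw
    obtain ⟨a, ha⟩ := hw
    have h3 := congrFun ha 1
    simp only [Pi.smul_apply, smul_eq_mul, Matrix.cons_val_one, Matrix.cons_val_zero] at h3
    have ha1 : a1 ≠ 0 := by rintro rfl; simp at h1; exact hv1 h1
    rw [h1, ← mul_assoc] at h3
    have h4 : a * g = 1 := mul_right_cancel₀ ha1 (by rw [h3, one_mul])
    exact IsUnit.of_mul_eq_one a (by rw [mul_comm]; exact h4)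
  have hdvd : ∀ i, v 1 ∣ r 0 i := by
    intro i
    apply hcop.dvd_of_dvd_mul_left
    exact ⟨- r 1 i, by linear_combination hrel i⟩
  choose s hs using hdvd
  have hs' : r 0 = v 1 • s := by ext1 i; simp [hs]
  have hsA : s ∈ ARmod f := by
    have := hrA 0
    rw [ARmod, LinearMap.mem_ker, hs', map_smul] at this
    exact (smul_eq_zero.mp this).resolve_left hv1
  rw [← hspan, ← range_syzMap] at hsA
  obtain ⟨u, hu⟩ := hsA
  have hvu : syzMap r (v 1 • u) = r 0 := by rw [map_smul, hu, hs']
  have hg := graded_gen r dd hr (dd 0) (r 0) _ (fun i => by rw [GG_nat]; exact hr 0 i) hvu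
  have hw0 : gcmp ((dd 0 : ℤ) - dd 0) ((v 1 • u) 0) = 0 := by
    rw [sub_self, Pi.smul_apply, smul_eq_mul, mul_comm, gcmp_mul _ _ _ _ (hvd 1)]
    rw [gcmp, if_neg (by omega)]; simp
  set w := fun j => gcmp ((dd 0 : ℤ) - dd j) ((v 1 • u) j) with hw
  apply hmin 0
  apply mem_span_of_unit r (w - Pi.single 0 1) 0
  · rw [map_sub, hg, sub_eq_zero]
    ext1 i
    rw [syzMap_apply, Fin.sum_univ_three]
    simp
  · have : (w - Pi.single 0 1 : Fin 3 → S) 0 = -1 := by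
      have hw0' : w 0 = 0 := hw0
      simp [hw0']
    rw [this]; simp

theorem arith_part (m : ℕ → ℤ) (g : ℤ → ℤ) (e d1 d2 d3 : ℕ) (c τ : ℤ)
    (hg : ∀ n, -2 ≤ n → 2 * g n = (n + 1) * (n + 2)) (hgn : g (-3) = 0)
    (hm : ∀ k : ℕ, m k = g k - 3 * g (k - e) + (g (k - e - d1) + g (k - e - d2) + g (k - e - d3))
      - g (k - e - c))
    (h12 : d1 ≤ d2) (h23 : d2 ≤ d3) (hc : d3 + 1 ≤ c)
    (hτ : ∃ N : ℕ, ∀ k ≥ N, m k = τ) :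
    c = d1 + d2 + d3 - e ∧
    τ = e * ((d1 : ℤ) + d2 + d3) - ((d1 : ℤ) * d2 + (d1 : ℤ) * d3 + (d2 : ℤ) * d3) ∧
    (∀ k : ℕ, c + e - 2 ≤ (k : ℤ) → m k = τ) ∧
    (∀ k : ℕ, (k : ℤ) = c + e - 3 → m k = τ + 1) := by
  obtain ⟨N, hN⟩ := hτ
  have hc0 : c = d1 + d2 + d3 - e := by
    have key : ∀ n : ℕ, N + e + d1 + d2 + d3 + c.toNat ≤ n → 2 * τ =
      ((n : ℤ) + 1) * (n + 2) - 3 * ((n - e + 1) * (n - e + 2)) +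
        ((n - e - d1 + 1) * (n - e - d1 + 2) + (n - e - d2 + 1) * (n - e - d2 + 2) +
          (n - e - d3 + 1) * (n - e - d3 + 2)) - (n - e - c + 1) * (n - e - c + 2) := by
      intro n hn
      rw [← hN n (by omega), hm, ← hg n (by omega), ← hg (n - e) (by omega),
        ← hg (n - e - d1) (by omega), ← hg (n - e - d2) (by omega), ← hg (n - e - d3) (by omega),
        ← hg (n - e - c) (by omega)]
      ring
    have k1 := key (N + e + d1 + d2 + d3 + c.toNat) le_rfl
    have k2 := key (N + e + d1 + d2 + d3 + c.toNat + 1) (by omega)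
    generalize N + e + d1 + d2 + d3 + c.toNat = n at k1 k2
    push_cast at k1 k2
    linarith
  have hk : ∀ k : ℕ, c + e - 3 ≤ k → 2 * m k =
      2 * (e * ((d1 : ℤ) + d2 + d3) - ((d1 : ℤ) * d2 + (d1 : ℤ) * d3 + (d2 : ℤ) * d3))
        + ((k - e - c + 1) * (k - e - c + 2) - 2 * g (k - e - c)) := by
    intro n hn
    have a0 := hg n (by omega)
    have a1 := hg (n - e) (by omega)
    have a2 := hg (n - e - d1) (by omega)
    have a3 := hg (n - e - d2) (by omega)
    have a4 := hg (n - e - d3) (by omega)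
    rw [hm]
    generalize g (n - e - c) = G
    subst hc0
    linear_combination a0 - 3 * a1 + a2 + a3 + a4
  have hk1 : ∀ k : ℕ, c + e - 2 ≤ k → m k =
      (e * ((d1 : ℤ) + d2 + d3) - ((d1 : ℤ) * d2 + (d1 : ℤ) * d3 + (d2 : ℤ) * d3)) := by
    intro n hn
    have := hk n (by omega)
    have := hg (n - e - c) (by omega)
    linarith
  have hτ' : τ = e * ((d1 : ℤ) + d2 + d3) - ((d1 : ℤ) * d2 + (d1 : ℤ) * d3 + (d2 : ℤ) * d3) := by
    rw [← hN (N + (c + e).toNat) (by omega)]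
    exact hk1 _ (by omega)
  refine ⟨hc0, hτ', fun k h => by rw [hτ']; exact hk1 k h, fun k h => ?_⟩
  have := hk k (by omega)
  rw [show (k : ℤ) - e - c = -3 by omega, hgn] at this
  linarith

theorem stmt3 (f : S) (d : ℕ) (hhom : f.IsHomogeneous d) (hred : Squarefree f)
    (hnc : ¬ IsConeOfLines f) (d1 d2 d3 : ℕ) (b : ℤ) (h12 : d1 ≤ d2) (h23 : d2 ≤ d3)
    (hres : HasResolution f d ![d1, d2, d3] b) (τ : ℕ) (hτ : TjurinaIs f τ) :
    d ≤ d1 + d2 ∧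
    b = (d1 : ℤ) + d2 + d3 - 2 * ((d : ℤ) - 1) ∧
    (τ : ℤ) = ((d : ℤ) - 1) * ((d1 : ℤ) + d2 + d3)
        - ((d1 : ℤ) * d2 + (d1 : ℤ) * d3 + (d2 : ℤ) * d3) ∧
    IsLeast (mdrSet f) d1 ∧
    (∀ k : ℕ, b + 2 * (d : ℤ) - 4 ≤ (k : ℤ) → mdim f k = τ) ∧
    (∀ k : ℕ, (k : ℤ) = b + 2 * (d : ℤ) - 5 → mdim f k = τ + 1) := by
  have hf0 : f ≠ 0 := hred.ne_zero
  have hd : d ≠ 0 := by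
    rintro rfl
    apply hnc
    refine ⟨fun _ => 1, fun h => one_ne_zero (congrFun h 0), coeff 0 f, 0, by simp, ?_⟩
    have h1 := gcmp_of_mem 0 0 f hhom
    simpa [gcmp] using h1.symm
  obtain ⟨e, rfl⟩ : ∃ e, d = e + 1 := ⟨d - 1, by omega⟩
  have hf : ∀ i, pderiv i f ∈ Sgr e := fun i => by
    have := hhom.pderiv (i := i)
    rw [Nat.add_sub_cancel] at this
    exact this
  obtain ⟨r, hrA, hr, hspan, hmin, v, hv0, hv, hker⟩ := hres
  choose vd hvd1 hvd using hv
  have hpos := vdeg_pos f hf0 _ r hr hrA hspan hmin v hv0 vd hvd hker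
  have hH := hilb f e hf _ r hr hspan v hv0 vd hvd (b + e)
    (fun j => by rw [hvd1 j]; push_cast; ring) hker
  have hlast := hvd1 2
  simp only [Fin.sum_univ_three, Matrix.cons_val_zero, Matrix.cons_val_one,
    Matrix.cons_val] at hH hlast
  obtain ⟨N, hN⟩ := hτ
  have hA := arith_part (fun k => (mdim f k : ℤ)) (fun n => (Module.finrank ℂ (GG n) : ℤ))
    e d1 d2 d3 (b + e) τ finrank_GG (by rw [GG_neg _ (by norm_num)]; simp) hH h12 h23
    (by push_cast at hlast; omega) ⟨N, fun k hk => by simp only [hN k hk]⟩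
  obtain ⟨A1, A2, A3, A4⟩ := hA
  push_cast at hlast ⊢
  refine ⟨by omega, by omega, by rw [A2]; ring, ⟨⟨r 0, hrA 0, ?_, hr 0⟩, ?_⟩, ?_, ?_⟩
  · intro h
    exact hmin 0 (h ▸ Submodule.zero_mem _)
  · rintro m ⟨x, hx, hx0, hxm⟩
    by_contra hlt
    apply hx0
    rw [← hspan, ← range_syzMap] at hx
    obtain ⟨u, hu⟩ := hx
    have hg := graded_gen r _ hr m x u (fun i => by rw [GG_nat]; exact hxm i) hu
    rw [← hg]
    have hz : (fun j => gcmp ((m : ℤ) - (![d1, d2, d3] j : ℕ)) (u j)) = 0 := by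
      ext1 j
      have : ¬ (0 : ℤ) ≤ (m : ℤ) - (![d1, d2, d3] j : ℕ) := by
        fin_cases j <;> simp <;> omega
      rw [gcmp, if_neg this]
      rfl
    rw [hz, map_zero]
  · intro k hk
    exact_mod_cast A3 k (by omega)
  · intro k hk
    exact_mod_cast A4 k (by omega)

end
end
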